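/- Let β_N ∈ (0,1), let ν_N = −(1/2)·ln(1 − β_N²) − β_N²/2, let W_N = (F_N(β_N) − E F_N(β_N))/√(ν_N), and let g be a standard Gaussian random variable. Then d_TV(W_N, g) ≤ (β_N²/ν_N)·∫₀¹ E| N·⟨R(σ,τ)²⟩_t − 1/(1 − β_N² t) | dt, where d_TV(X,Y) = sup_A |P(X ∈ A) − P(Y ∈ A)| is the total variation distance. -/

import Mathlib

open MeasureTheory ProbabilityTheory Real Finset Filter

noncomputable section

/-- Spin configurations: each of the `N` sites carries a `±1` spin, encoded by a `Bool`. -/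
abbrev Config (N : ℕ) := Fin N → Bool

/-- The `±1` value of a spin. -/
def spin (b : Bool) : ℝ := if b then 1 else -1

/-- The value of the last spin `σ_N` (junk value `0` when `N = 0`). -/
def spinLast {N : ℕ} (σ : Config N) : ℝ :=
  if h : 0 < N then spin (σ ⟨N - 1, Nat.sub_lt h Nat.one_pos⟩) else 0

/-- The Gaussian disorder: i.i.d. standard Gaussians indexed by pairs `(i, j)`
(only the entries with `i < j` are used). -/
def gaussPi (N : ℕ) : Measure (Fin N × Fin N → ℝ) :=
  Measure.pi fun _ => gaussianReal 0 1

instance (N : ℕ) : IsProbabilityMeasure (gaussPi N) := by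
  unfold gaussPi; infer_instance

/-- Three independent copies `g, g', g''` of the disorder. -/
def disM3 (N : ℕ) :
    Measure ((Fin N × Fin N → ℝ) × (Fin N × Fin N → ℝ) × (Fin N × Fin N → ℝ)) :=
  (gaussPi N).prod ((gaussPi N).prod (gaussPi N))

/-- The SK Hamiltonian `H_{N,β}(σ) = (β/√N) ∑_{i<j} g_{ij} σ_i σ_j`. -/
def ham (N : ℕ) (β : ℝ) (g : Fin N × Fin N → ℝ) (σ : Config N) : ℝ :=
  (β / Real.sqrt N) *
    ∑ p ∈ Finset.univ.filter (fun p : Fin N × Fin N => p.1 < p.2),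
      g p * spin (σ p.1) * spin (σ p.2)

/-- The cavity Hamiltonian `H⁻_N(σ) = (β/√N) ∑_{i<j<N} g_{ij} σ_i σ_j` on the first
`N - 1` spins. -/
def hamCav (N : ℕ) (β : ℝ) (g : Fin N × Fin N → ℝ) (σ : Config N) : ℝ :=
  (β / Real.sqrt N) *
    ∑ p ∈ Finset.univ.filter
        (fun p : Fin N × Fin N => p.1 < p.2 ∧ (p.2 : ℕ) < N - 1),
      g p * spin (σ p.1) * spin (σ p.2)

/-- The overlap `R(σ¹,σ²) = (1/N) ∑_{i ≤ N} σ_i¹ σ_i²`. -/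
def ovlp (N : ℕ) (σ τ : Config N) : ℝ := (∑ i, spin (σ i) * spin (τ i)) / N

/-- The truncated overlap `R⁻(σ¹,σ²) = (1/N) ∑_{i ≤ N−1} σ_i¹ σ_i²`. -/
def ovlpm (N : ℕ) (σ τ : Config N) : ℝ :=
  (∑ i ∈ Finset.univ.filter (fun i : Fin N => (i : ℕ) < N - 1),
    spin (σ i) * spin (τ i)) / N

/-- The partition function `Z_N(β)`. -/
def partFun (N : ℕ) (β : ℝ) (g : Fin N × Fin N → ℝ) : ℝ :=
  ∑ σ : Config N, Real.exp (ham N β g σ)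

/-- The free energy `F_N(β) = ln Z_N(β)`. -/
def freeEnergy (N : ℕ) (β : ℝ) (g : Fin N × Fin N → ℝ) : ℝ :=
  Real.log (partFun N β g)

/-- Two-replica Gibbs average `⟨f⟩` for the single SK system. -/
def gibbs2 (N : ℕ) (β : ℝ) (g : Fin N × Fin N → ℝ)
    (f : Config N → Config N → ℝ) : ℝ :=
  (∑ σ : Config N, ∑ τ : Config N,
    f σ τ * Real.exp (ham N β g σ + ham N β g τ)) / (partFun N β g) ^ 2

/-- Disorder expectation of the two-replica Gibbs average. -/
def Egibbs2 (N : ℕ) (β : ℝ) (f : Config N → Config N → ℝ) : ℝ :=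
  ∫ g, gibbs2 N β g f ∂gaussPi N

/-- The interpolated Hamiltonian `√t · H_N + √(1−t) · H'_N`. -/
def hamT (N : ℕ) (β t : ℝ) (g g' : Fin N × Fin N → ℝ) (σ : Config N) : ℝ :=
  Real.sqrt t * ham N β g σ + Real.sqrt (1 - t) * ham N β g' σ

/-- The coupled Gibbs weight `exp(H¹_{N,t}(σ) + H²_{N,t}(τ))`. -/
def wT (N : ℕ) (β t : ℝ) (g g' g'' : Fin N × Fin N → ℝ)
    (ρ : Config N × Config N) : ℝ :=
  Real.exp (hamT N β t g g' ρ.1 + hamT N β t g g'' ρ.2)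

/-- The coupled Gibbs average `⟨f⟩_t` of a function of one pair `(σ, τ)`. -/
def gibbsT (N : ℕ) (β t : ℝ) (g g' g'' : Fin N × Fin N → ℝ)
    (f : Config N × Config N → ℝ) : ℝ :=
  (∑ ρ : Config N × Config N, f ρ * wT N β t g g' g'' ρ) /
    (∑ ρ : Config N × Config N, wT N β t g g' g'' ρ)

/-- The coupled Gibbs average `⟨f⟩_t` of a function of two pairs. -/
def gibbsT2 (N : ℕ) (β t : ℝ) (g g' g'' : Fin N × Fin N → ℝ)
    (f : Config N × Config N → Config N × Config N → ℝ) : ℝ :=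
  (∑ ρ₁ : Config N × Config N, ∑ ρ₂ : Config N × Config N,
    f ρ₁ ρ₂ * wT N β t g g' g'' ρ₁ * wT N β t g g' g'' ρ₂) /
    (∑ ρ : Config N × Config N, wT N β t g g' g'' ρ) ^ 2

/-- Disorder expectation `E⟨f⟩_t` (one pair). -/
def EgibbsT (N : ℕ) (β t : ℝ) (f : Config N × Config N → ℝ) : ℝ :=
  ∫ ω, gibbsT N β t ω.1 ω.2.1 ω.2.2 f ∂disM3 N

/-- Disorder expectation `E⟨f⟩_t` (two pairs). -/
def EgibbsT2 (N : ℕ) (β t : ℝ)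
    (f : Config N × Config N → Config N × Config N → ℝ) : ℝ :=
  ∫ ω, gibbsT2 N β t ω.1 ω.2.1 ω.2.2 f ∂disM3 N

/-- The `s`-dependent cavity field term
`(β/√N) σ_N ∑_{i<N} (√t g_{iN} + √(1−t) g'_{iN}) σ_i`. -/
def cavField (N : ℕ) (β t : ℝ) (g g' : Fin N × Fin N → ℝ) (σ : Config N) : ℝ :=
  if h : 0 < N then
    (β / Real.sqrt N) * spin (σ ⟨N - 1, Nat.sub_lt h Nat.one_pos⟩) *
      ∑ i ∈ Finset.univ.filter (fun i : Fin N => (i : ℕ) < N - 1),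
        (Real.sqrt t * g (i, ⟨N - 1, Nat.sub_lt h Nat.one_pos⟩) +
          Real.sqrt (1 - t) * g' (i, ⟨N - 1, Nat.sub_lt h Nat.one_pos⟩)) * spin (σ i)
  else 0

/-- The cavity-interpolated Hamiltonian `H^1_{N,t,s}` (resp. `H^2_{N,t,s}` with `g''`). -/
def hamTS (N : ℕ) (β t s : ℝ) (g g' : Fin N × Fin N → ℝ) (σ : Config N) : ℝ :=
  Real.sqrt t * hamCav N β g σ + Real.sqrt (1 - t) * hamCav N β g' σ +
    Real.sqrt s * cavField N β t g g' σ

/-- The coupled cavity Gibbs weight `exp(H¹_{N,t,s}(σ) + H²_{N,t,s}(τ))`. -/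
def wTS (N : ℕ) (β t s : ℝ) (g g' g'' : Fin N × Fin N → ℝ)
    (ρ : Config N × Config N) : ℝ :=
  Real.exp (hamTS N β t s g g' ρ.1 + hamTS N β t s g g'' ρ.2)

/-- The coupled cavity Gibbs average `⟨f⟩_{t,s}` of a function of one pair. -/
def gibbsTS1 (N : ℕ) (β t s : ℝ) (g g' g'' : Fin N × Fin N → ℝ)
    (f : Config N × Config N → ℝ) : ℝ :=
  (∑ ρ : Config N × Config N, f ρ * wTS N β t s g g' g'' ρ) /
    (∑ ρ : Config N × Config N, wTS N β t s g g' g'' ρ)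

/-- The coupled cavity Gibbs average `⟨f⟩_{t,s}` of a function of two pairs. -/
def gibbsTS2 (N : ℕ) (β t s : ℝ) (g g' g'' : Fin N × Fin N → ℝ)
    (f : Config N × Config N → Config N × Config N → ℝ) : ℝ :=
  (∑ ρ₁ : Config N × Config N, ∑ ρ₂ : Config N × Config N,
    f ρ₁ ρ₂ * wTS N β t s g g' g'' ρ₁ * wTS N β t s g g' g'' ρ₂) /
    (∑ ρ : Config N × Config N, wTS N β t s g g' g'' ρ) ^ 2

/-- The coupled cavity Gibbs average `⟨f⟩_{t,s}` of a function of `n` pairs. -/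
def gibbsTSn (N : ℕ) (β t s : ℝ) (g g' g'' : Fin N × Fin N → ℝ) {n : ℕ}
    (f : (Fin n → Config N × Config N) → ℝ) : ℝ :=
  (∑ ρ : Fin n → Config N × Config N, f ρ * ∏ l, wTS N β t s g g' g'' (ρ l)) /
    (∑ ρ₀ : Config N × Config N, wTS N β t s g g' g'' ρ₀) ^ n

/-- Disorder expectation `E⟨f⟩_{t,s}` (one pair). -/
def EgibbsTS1 (N : ℕ) (β t s : ℝ) (f : Config N × Config N → ℝ) : ℝ :=
  ∫ ω, gibbsTS1 N β t s ω.1 ω.2.1 ω.2.2 f ∂disM3 N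

/-- Disorder expectation `E⟨f⟩_{t,s}` (two pairs). -/
def EgibbsTS2 (N : ℕ) (β t s : ℝ)
    (f : Config N × Config N → Config N × Config N → ℝ) : ℝ :=
  ∫ ω, gibbsTS2 N β t s ω.1 ω.2.1 ω.2.2 f ∂disM3 N

/-- Disorder expectation `E⟨f⟩_{t,s}` (`n` pairs). -/
def EgibbsTSn (N : ℕ) (β t s : ℝ) {n : ℕ}
    (f : (Fin n → Config N × Config N) → ℝ) : ℝ :=
  ∫ ω, gibbsTSn N β t s ω.1 ω.2.1 ω.2.2 f ∂disM3 N

/-- The covariance kernel `U(ρ, ρ')` of the `s`-part of the coupled cavity Hamiltonians. -/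
def Ufun (N : ℕ) (β t : ℝ) (ρ ρ' : Config N × Config N) : ℝ :=
  β ^ 2 / 2 * (spinLast ρ.1 * spinLast ρ'.1 * ovlpm N ρ.1 ρ'.1 +
      spinLast ρ.2 * spinLast ρ'.2 * ovlpm N ρ.2 ρ'.2) +
    β ^ 2 * t / 2 * (spinLast ρ.1 * spinLast ρ'.2 * ovlpm N ρ.1 ρ'.2 +
      spinLast ρ.2 * spinLast ρ'.1 * ovlpm N ρ.2 ρ'.1)

/-- `ν(β) = −(1/2)·ln(1 − β²) − β²/2`. -/
def nuSK (b : ℝ) : ℝ := -(1 / 2) * Real.log (1 - b ^ 2) - b ^ 2 / 2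

/-! ### Polynomially bounded continuous functions -/

/-- `u` is continuous and bounded by a polynomial in the size function `m`. -/
def PolyBdd {X : Type*} [TopologicalSpace X] (m u : X → ℝ) : Prop :=
  Continuous u ∧ ∃ C : ℝ, ∃ k : ℕ, 0 ≤ C ∧ ∀ x, |u x| ≤ C * (1 + |m x|) ^ k

namespace PolyBdd

variable {X Y : Type*} [TopologicalSpace X] [TopologicalSpace Y] {m u v : X → ℝ}

theorem of_bounded (hu : Continuous u) (C : ℝ) (h : ∀ x, |u x| ≤ C) : PolyBdd m u := by
  refine ⟨hu, |C|, 0, abs_nonneg _, fun x => ?_⟩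
  simpa using (h x).trans (le_abs_self C)

theorem const (c : ℝ) : PolyBdd m fun _ => c :=
  of_bounded continuous_const |c| fun _ => le_rfl

theorem of_linear (hu : Continuous u) (C : ℝ) (h : ∀ x, |u x| ≤ C * (1 + |m x|)) :
    PolyBdd m u := by
  refine ⟨hu, |C|, 1, abs_nonneg _, fun x => ?_⟩
  rw [pow_one]
  exact (h x).trans (by gcongr; exact le_abs_self C)

theorem add (hu : PolyBdd m u) (hv : PolyBdd m v) : PolyBdd m fun x => u x + v x := by
  obtain ⟨cu, C, k, hC, hk⟩ := hu
  obtain ⟨cv, D, l, hD, hl⟩ := hv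
  refine ⟨cu.add cv, C + D, k + l, by positivity, fun x => ?_⟩
  have h1 : (1 : ℝ) ≤ 1 + |m x| := by linarith [abs_nonneg (m x)]
  have hk' : (1 + |m x|) ^ k ≤ (1 + |m x|) ^ (k + l) := pow_le_pow_right₀ h1 (by omega)
  have hl' : (1 + |m x|) ^ l ≤ (1 + |m x|) ^ (k + l) := pow_le_pow_right₀ h1 (by omega)
  calc |u x + v x| ≤ |u x| + |v x| := abs_add_le _ _
    _ ≤ C * (1 + |m x|) ^ (k + l) + D * (1 + |m x|) ^ (k + l) := by
        refine add_le_add ((hk x).trans ?_) ((hl x).trans ?_) <;> gcongr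
    _ = _ := by ring

theorem mul (hu : PolyBdd m u) (hv : PolyBdd m v) : PolyBdd m fun x => u x * v x := by
  obtain ⟨cu, C, k, hC, hk⟩ := hu
  obtain ⟨cv, D, l, hD, hl⟩ := hv
  refine ⟨cu.mul cv, C * D, k + l, by positivity, fun x => ?_⟩
  calc |u x * v x| = |u x| * |v x| := abs_mul _ _
    _ ≤ (C * (1 + |m x|) ^ k) * (D * (1 + |m x|) ^ l) := by
        gcongr
        · exact hk x
        · exact hl x
    _ = _ := by ring

theorem neg (hu : PolyBdd m u) : PolyBdd m fun x => - u x := by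
  simpa using (const (m := m) (-1)).mul hu

theorem sub (hu : PolyBdd m u) (hv : PolyBdd m v) : PolyBdd m fun x => u x - v x := by
  simpa [sub_eq_add_neg] using hu.add hv.neg

theorem sum {ι : Type*} (s : Finset ι) {w : ι → X → ℝ} (h : ∀ i ∈ s, PolyBdd m (w i)) :
    PolyBdd m fun x => ∑ i ∈ s, w i x := by
  classical
  induction s using Finset.induction_on with
  | empty => simpa using const (m := m) 0
  | insert a s ha ih =>
    simp only [Finset.sum_insert ha]
    exact (h a (Finset.mem_insert_self _ _)).add
      (ih fun i hi => h i (Finset.mem_insert_of_mem hi))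

theorem abs (hu : PolyBdd m u) : PolyBdd m fun x => |u x| := by
  obtain ⟨cu, C, k, hC, hk⟩ := hu
  exact ⟨cu.abs, C, k, hC, fun x => by simpa using hk x⟩

theorem comp (hu : PolyBdd m u) {m' : Y → ℝ} {f : Y → X} (hf : Continuous f) (K : ℝ)
    (h : ∀ y, |m (f y)| ≤ K * (1 + |m' y|)) : PolyBdd m' fun y => u (f y) := by
  obtain ⟨cu, C, k, hC, hk⟩ := hu
  refine ⟨cu.comp hf, C * (1 + |K|) ^ k, k, by positivity, fun y => ?_⟩
  refine (hk _).trans ?_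
  rw [mul_assoc, ← mul_pow]
  have h1 : 1 + |m (f y)| ≤ (1 + |K|) * (1 + |m' y|) := by
    have h2 : K * (1 + |m' y|) ≤ |K| * (1 + |m' y|) := by gcongr; exact le_abs_self K
    nlinarith [h y, abs_nonneg (m' y)]
  gcongr

/-- A section of a family of functions with a uniform polynomial bound. -/
theorem section_right {Θ E : Type*} [TopologicalSpace Θ] [SeminormedAddCommGroup E]
    {w : Θ × E → ℝ} (hw : PolyBdd (fun q => ‖q.2‖) w) (θ : Θ) :
    PolyBdd (fun x => ‖x‖) fun x => w (θ, x) :=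
  hw.comp (f := fun x => (θ, x)) (by fun_prop) 1 fun x => by simp

end PolyBdd

/-! ### Gaussian measures and integration by parts -/

/-- The standard Gaussian measure on `κ → ℝ`. -/
abbrev stdPi (κ : Type*) [Fintype κ] : Measure (κ → ℝ) := Measure.pi fun _ => gaussianReal 0 1

instance isGaussian_stdPi (κ : Type*) [Fintype κ] : IsGaussian (stdPi κ) := by
  have h := map_pi_eq_stdGaussian (ι := κ)
  have h2 : stdPi κ = (stdGaussian (EuclideanSpace ℝ κ)).map
      (EuclideanSpace.equiv κ ℝ : EuclideanSpace ℝ κ ≃L[ℝ] (κ → ℝ)) := by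
    rw [← h, Measure.map_map (by fun_prop) (by fun_prop)]
    exact Measure.map_id.symm
  rw [h2]
  infer_instance

namespace PolyBdd

theorem integrable {E : Type*} [NormedAddCommGroup E] [NormedSpace ℝ E] [MeasurableSpace E]
    [BorelSpace E] [SecondCountableTopology E] [CompleteSpace E] {μ : Measure E} [IsGaussian μ]
    {u : E → ℝ} (hu : PolyBdd (fun x => ‖x‖) u) : Integrable u μ := by
  obtain ⟨cu, C, k, hC, hk⟩ := hu
  have hm : Integrable (fun x : E => C * (1 + ‖x‖) ^ k) μ := by
    refine Integrable.const_mul ?_ C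
    have h0 : MemLp (fun x : E => ‖x‖) k μ := by
      simpa using (IsGaussian.memLp_id μ (k : ENNReal) (ENNReal.natCast_ne_top k)).norm
    have h1 : MemLp (fun x : E => 1 + ‖x‖) k μ := (memLp_const (1 : ℝ)).add h0
    refine (h1.integrable_norm_pow').congr (ae_of_all _ fun x => ?_)
    simp only [Real.norm_eq_abs]
    rw [abs_of_nonneg (by positivity)]
  exact hm.mono' cu.aestronglyMeasurable (ae_of_all _ fun x => by simpa using hk x)

theorem continuous_integral {Θ E : Type*} [TopologicalSpace Θ] [FirstCountableTopology Θ]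
    [NormedAddCommGroup E] [NormedSpace ℝ E] [MeasurableSpace E]
    [BorelSpace E] [SecondCountableTopology E] [CompleteSpace E] {μ : Measure E} [IsGaussian μ]
    {w : Θ × E → ℝ} (hw : PolyBdd (fun q => ‖q.2‖) w) :
    Continuous fun θ => ∫ x, w (θ, x) ∂μ := by
  have hw' := hw
  obtain ⟨cw, C, k, hC, hk⟩ := hw
  have hb : PolyBdd (fun x : E => ‖x‖) fun x => C * (1 + ‖x‖) ^ k :=
    ⟨by fun_prop, C, k, hC, fun x => by
      rw [abs_of_nonneg (by positivity), abs_of_nonneg (norm_nonneg x)]⟩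
  refine continuous_of_dominated (bound := fun x => C * (1 + ‖x‖) ^ k)
    (fun θ => (hw'.section_right θ).1.aestronglyMeasurable)
    (fun θ => ae_of_all _ fun x => by simpa using hk (θ, x)) hb.integrable
    (ae_of_all _ fun x => by fun_prop)

end PolyBdd

/-- **Stein's identity** for the standard Gaussian measure on the line. -/
theorem integral_id_mul_gaussianReal {u v : ℝ → ℝ} (hu : PolyBdd (fun x => ‖x‖) u)
    (hv : PolyBdd (fun x => ‖x‖) v) (h : ∀ x, HasDerivAt u (v x) x) :
    ∫ x, x * u x ∂gaussianReal 0 1 = ∫ x, v x ∂gaussianReal 0 1 := by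
  have hd : ∀ x, HasDerivAt (gaussianPDFReal 0 1) (-x * gaussianPDFReal 0 1 x) x := by
    intro x
    have h1 : HasDerivAt (fun x : ℝ => -(x - 0) ^ 2 / (2 * ((1 : NNReal) : ℝ))) (-x) x := by
      convert! (((hasDerivAt_id x).sub_const 0).pow 2).neg.div_const (2 * ((1 : NNReal) : ℝ)) using 1
      simp
      ring
    convert! (h1.exp).const_mul (√(2 * π * ((1 : NNReal) : ℝ)))⁻¹ using 1
    simp only [gaussianPDFReal]
    ring
  have key : ∀ w : ℝ → ℝ, PolyBdd (fun x => ‖x‖) w →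
      Integrable fun x => w x * gaussianPDFReal 0 1 x := by
    intro w hw
    have := hw.integrable (μ := gaussianReal 0 1)
    rw [gaussianReal_of_var_ne_zero _ one_ne_zero,
      integrable_withDensity_iff (measurable_gaussianPDF _ _)
        (ae_of_all _ fun _ => gaussianPDF_lt_top)] at this
    simpa using this
  have hx : PolyBdd (fun x : ℝ => ‖x‖) fun x => x :=
    PolyBdd.of_linear continuous_id 1 fun x => by simp
  have h2 := integral_mul_deriv_eq_deriv_mul_of_integrable
    (u := u) (v := gaussianPDFReal 0 1) (u' := v) (v' := fun x => -x * gaussianPDFReal 0 1 x)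
    (fun x _ => h x) (fun x _ => hd x)
    ((key _ (hu.mul hx).neg).congr (ae_of_all _ fun x => by simp; ring)) (key v hv) (key u hu)
  rw [integral_gaussianReal_eq_integral_smul one_ne_zero,
    integral_gaussianReal_eq_integral_smul one_ne_zero]
  simp only [smul_eq_mul]
  calc _ = - ∫ x, u x * (-x * gaussianPDFReal 0 1 x) := by
        rw [← integral_neg]; congr 1; ext x; ring
    _ = ∫ x, v x * gaussianPDFReal 0 1 x := by rw [h2, neg_neg]
    _ = _ := by congr 1; ext x; ring

/-- Resampling one coordinate preserves a product measure. -/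
theorem measurePreserving_update {κ : Type*} [Fintype κ] [DecidableEq κ] (k : κ) :
    MeasurePreserving (fun q : (κ → ℝ) × ℝ => Function.update q.1 k q.2)
      ((stdPi κ).prod (gaussianReal 0 1)) (stdPi κ) := by
  have hmeas : Measurable fun q : (κ → ℝ) × ℝ => Function.update q.1 k q.2 :=
    measurable_pi_iff.2 fun i => by
      by_cases h : i = k
      · subst h; simpa using measurable_snd
      · simp only [Function.update_of_ne h]; fun_prop
  refine ⟨hmeas, (Measure.pi_eq fun s hs => ?_).symm⟩
  rw [Measure.map_apply hmeas (MeasurableSet.univ_pi hs)]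
  have h1 : (fun q : (κ → ℝ) × ℝ => Function.update q.1 k q.2) ⁻¹' (Set.univ.pi s) =
      (Set.univ.pi (Function.update s k Set.univ)) ×ˢ s k := by
    ext q
    simp only [Set.mem_preimage, Set.mem_univ_pi, Set.mem_prod]
    constructor
    · intro h
      refine ⟨fun i => ?_, by simpa using h k⟩
      by_cases hi : i = k
      · subst hi; simp
      · simpa [hi] using h i
    · rintro ⟨h, hk⟩ i
      by_cases hi : i = k
      · subst hi; simpa using hk
      · simpa [hi] using h i
  rw [h1, Measure.prod_prod, Measure.pi_pi, ← Finset.mul_prod_erase _ _ (Finset.mem_univ k),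
    ← Finset.mul_prod_erase Finset.univ (fun i => gaussianReal 0 1 (s i)) (Finset.mem_univ k)]
  simp only [Function.update_self, measure_univ, one_mul]
  rw [mul_comm]
  congr 1
  refine Finset.prod_congr rfl fun i hi => ?_
  rw [Function.update_of_ne (Finset.ne_of_mem_erase hi)]

/-- **Gaussian integration by parts** in one coordinate. -/
theorem integral_coord_mul_stdPi {κ : Type*} [Fintype κ] [DecidableEq κ] (k : κ)
    {u v : (κ → ℝ) → ℝ} (hu : PolyBdd (fun x => ‖x‖) u) (hv : PolyBdd (fun x => ‖x‖) v)
    (h : ∀ x, HasLineDerivAt ℝ u (v x) x (Pi.single k 1)) :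
    ∫ x, x k * u x ∂stdPi κ = ∫ x, v x ∂stdPi κ := by
  have hp := measurePreserving_update k
  have key : ∀ w : (κ → ℝ) → ℝ, PolyBdd (fun x => ‖x‖) w →
      ∫ x, w x ∂stdPi κ =
        ∫ x, ∫ s, w (Function.update x k s) ∂gaussianReal 0 1 ∂stdPi κ := by
    intro w hw
    have hi : Integrable (fun q : (κ → ℝ) × ℝ => w (Function.update q.1 k q.2))
        ((stdPi κ).prod (gaussianReal 0 1)) :=
      hp.integrable_comp_of_integrable hw.integrable
    rw [← hp.map_eq, integral_map hp.measurable.aemeasurable hw.1.aestronglyMeasurable,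
      integral_prod _ hi]
    simp only [hp.map_eq]
  have hx : PolyBdd (fun x : κ → ℝ => ‖x‖) fun x => x k :=
    PolyBdd.of_linear (continuous_apply k) 1 fun x => by
      have := norm_le_pi_norm x k
      simp only [Real.norm_eq_abs] at this
      simp only [abs_norm]
      linarith
  rw [key _ (hx.mul hu), key _ hv]
  congr 1
  ext x
  simp only [Function.update_self]
  have hb : ∀ s : ℝ, |‖Function.update x k s‖| ≤ (1 + ‖x‖) * (1 + |‖s‖|) := by
    intro s
    rw [abs_norm, abs_norm]
    refine (pi_norm_le_iff_of_nonneg (by positivity)).2 fun i => ?_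
    by_cases hi : i = k
    · subst hi
      simp only [Function.update_self]
      nlinarith [norm_nonneg x, norm_nonneg s]
    · rw [Function.update_of_ne hi]
      nlinarith [norm_le_pi_norm x i, norm_nonneg x, norm_nonneg s]
  have hc : Continuous fun s : ℝ => Function.update x k s := by fun_prop
  refine integral_id_mul_gaussianReal (hu.comp hc _ hb) (hv.comp hc _ hb) fun s => ?_
  have h4 : HasDerivAt (fun t : ℝ => u (Function.update x k s + t • Pi.single k 1))
      (v (Function.update x k s)) (s - s) := by
    rw [sub_self]; exact h (Function.update x k s)
  have h5 := h4.comp_sub_const s s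
  refine h5.congr_of_eventuallyEq (Eventually.of_forall fun r => ?_)
  simp only
  congr 1
  ext i
  by_cases hi : i = k
  · subst hi; simp
  · simp [hi]

/-! ### Gaussian interpolation -/

section Interpolation

variable {ι : Type*}

/-- The rotation `sin θ · g + cos θ · g'`, where `g` is the first block of `ω` and `g'` is the
block of `ω` selected by `j`. -/
def mix (j : ι → ι ⊕ ι) (θ : ℝ) (ω : ι ⊕ (ι ⊕ ι) → ℝ) : ι → ℝ :=
  fun p => sin θ * ω (Sum.inl p) + cos θ * ω (Sum.inr (j p))

theorem mix_zero (j : ι → ι ⊕ ι) (ω : ι ⊕ (ι ⊕ ι) → ℝ) :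
    mix j 0 ω = fun p => ω (Sum.inr (j p)) := by
  ext p; simp [mix]

theorem mix_pi_div_two (j : ι → ι ⊕ ι) (ω : ι ⊕ (ι ⊕ ι) → ℝ) :
    mix j (π / 2) ω = fun p => ω (Sum.inl p) := by
  ext p; simp [mix]

theorem continuous_mix (j : ι → ι ⊕ ι) :
    Continuous fun q : ℝ × (ι ⊕ (ι ⊕ ι) → ℝ) => mix j q.1 q.2 := by
  unfold mix; fun_prop

theorem mix_add_inl [DecidableEq ι] (j : ι → ι ⊕ ι) (θ : ℝ) (ω : ι ⊕ (ι ⊕ ι) → ℝ) (p : ι) (t : ℝ) :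
    mix j θ (ω + t • Pi.single (Sum.inl p) 1) = mix j θ ω + (sin θ * t) • Pi.single p 1 := by
  ext q
  by_cases h : q = p
  · subst h; simp [mix]; ring
  · simp [mix, h]

theorem mix_add_inr [DecidableEq ι] (j : ι → ι ⊕ ι) (hj : Function.Injective j) (θ : ℝ)
    (ω : ι ⊕ (ι ⊕ ι) → ℝ) (p : ι) (t : ℝ) :
    mix j θ (ω + t • Pi.single (Sum.inr (j p)) 1) = mix j θ ω + (cos θ * t) • Pi.single p 1 := by
  ext q
  by_cases h : q = p
  · subst h; simp [mix]; ring
  · simp [mix, h, hj.eq_iff]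

theorem mix_add_inr_of_ne [DecidableEq ι] (j j' : ι → ι ⊕ ι) (hj : ∀ p q, j' q ≠ j p) (θ : ℝ)
    (ω : ι ⊕ (ι ⊕ ι) → ℝ) (p : ι) (t : ℝ) :
    mix j' θ (ω + t • Pi.single (Sum.inr (j p)) 1) = mix j' θ ω := by
  ext q
  simp [mix, hj]

theorem HasLineDerivAt.hasDerivAt_scale {E : Type*} [NormedAddCommGroup E] [NormedSpace ℝ E]
    {f : E → ℝ} {f' : ℝ} {x v : E} (h : HasLineDerivAt ℝ f f' x v) (a : ℝ) :
    HasDerivAt (fun t : ℝ => f (x + (a * t) • v)) (a * f') 0 := by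
  have h1 : HasDerivAt (fun t : ℝ => f (x + t • v)) f' (a * 0) := by rw [mul_zero]; exact h
  have h2 : HasDerivAt (fun t : ℝ => a * t) a 0 := by
    simpa using (hasDerivAt_id (0 : ℝ)).const_mul a
  rw [mul_comm a f']
  exact h1.comp (0 : ℝ) h2

variable [Fintype ι]

theorem norm_mix_le (j : ι → ι ⊕ ι) (θ : ℝ) (ω : ι ⊕ (ι ⊕ ι) → ℝ) :
    |‖mix j θ ω‖| ≤ 2 * (1 + |‖ω‖|) := by
  rw [abs_norm, abs_norm]
  refine (pi_norm_le_iff_of_nonneg (by positivity)).2 fun p => ?_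
  have h1 : ‖sin θ * ω (Sum.inl p)‖ ≤ 1 * ‖ω‖ := by
    rw [norm_mul]
    exact mul_le_mul (abs_sin_le_one θ) (norm_le_pi_norm ω _) (norm_nonneg _) zero_le_one
  have h2 : ‖cos θ * ω (Sum.inr (j p))‖ ≤ 1 * ‖ω‖ := by
    rw [norm_mul]
    exact mul_le_mul (abs_cos_le_one θ) (norm_le_pi_norm ω _) (norm_nonneg _) zero_le_one
  have h3 := norm_add_le (sin θ * ω (Sum.inl p)) (cos θ * ω (Sum.inr (j p)))
  simp only [mix]
  linarith

theorem PolyBdd.comp_mix {u : (ι → ℝ) → ℝ} (hu : PolyBdd (fun x => ‖x‖) u) (j : ι → ι ⊕ ι) :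
    PolyBdd (fun q : ℝ × (ι ⊕ (ι ⊕ ι) → ℝ) => ‖q.2‖) fun q => u (mix j q.1 q.2) :=
  hu.comp (continuous_mix j) 2 fun q => norm_mix_le j q.1 q.2

theorem polyBdd_rotated_coord (j : ι → ι ⊕ ι) (p : ι) :
    PolyBdd (fun q : ℝ × (ι ⊕ (ι ⊕ ι) → ℝ) => ‖q.2‖)
      fun q => cos q.1 * q.2 (Sum.inl p) - sin q.1 * q.2 (Sum.inr (j p)) := by
  have hc : ∀ k, PolyBdd (fun q : ℝ × (ι ⊕ (ι ⊕ ι) → ℝ) => ‖q.2‖) fun q => q.2 k := fun k =>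
    PolyBdd.of_linear (by fun_prop) 1 fun q => by
      have := norm_le_pi_norm q.2 k
      simp only [Real.norm_eq_abs] at this
      simp only [abs_norm]
      linarith
  exact ((PolyBdd.of_bounded (by fun_prop) 1 fun q => abs_cos_le_one _).mul (hc _)).sub
    ((PolyBdd.of_bounded (by fun_prop) 1 fun q => abs_sin_le_one _).mul (hc _))

variable [DecidableEq ι]

/-- `dφ p` and `ddφ p` are the first and second derivatives of `φ` in the coordinate `p`, and
all these functions are polynomially bounded. -/
structure PolySmooth (φ : (ι → ℝ) → ℝ) (dφ ddφ : ι → (ι → ℝ) → ℝ) : Prop where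
  hasFDerivAt : ∀ x, HasFDerivAt φ
    (∑ p, dφ p x • (ContinuousLinearMap.proj p : (ι → ℝ) →L[ℝ] ℝ)) x
  hasLineDerivAt : ∀ p x, HasLineDerivAt ℝ (dφ p) (ddφ p x) x (Pi.single p 1)
  poly : PolyBdd (fun x => ‖x‖) φ
  poly_d : ∀ p, PolyBdd (fun x => ‖x‖) (dφ p)
  poly_dd : ∀ p, PolyBdd (fun x => ‖x‖) (ddφ p)

variable {φ ψ : (ι → ℝ) → ℝ} {dφ ddφ dψ ddψ : ι → (ι → ℝ) → ℝ}

theorem PolySmooth.hasLineDerivAt_self (h : PolySmooth φ dφ ddφ) (p : ι) (x : ι → ℝ) :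
    HasLineDerivAt ℝ φ (dφ p x) x (Pi.single p 1) := by
  have := (h.hasFDerivAt x).hasLineDerivAt (Pi.single p 1)
  simpa [Pi.single_apply] using this

theorem PolySmooth.const (c : ℝ) :
    PolySmooth (fun _ : ι → ℝ => c) (fun _ _ => 0) (fun _ _ => 0) where
  hasFDerivAt x := by simpa using hasFDerivAt_const c x
  hasLineDerivAt p x := by
    simpa using (hasFDerivAt_const (0 : ℝ) x).hasLineDerivAt (Pi.single p (1 : ℝ))
  poly := PolyBdd.const c
  poly_d _ := PolyBdd.const 0
  poly_dd _ := PolyBdd.const 0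

/-- Integration by parts along the direction orthogonal to the interpolation. -/
theorem integral_rotated_coord_mul (hφ : PolySmooth φ dφ ddφ) (hψ : PolySmooth ψ dψ ddψ)
    {j j' : ι → ι ⊕ ι} (hj : Function.Injective j) (hjj : ∀ p q, j' q ≠ j p) (θ : ℝ) (p : ι) :
    ∫ ω, (cos θ * ω (Sum.inl p) - sin θ * ω (Sum.inr (j p))) *
        (dφ p (mix j θ ω) * ψ (mix j' θ ω)) ∂stdPi (ι ⊕ (ι ⊕ ι)) =
      sin θ * cos θ * ∫ ω, dφ p (mix j θ ω) * dψ p (mix j' θ ω) ∂stdPi (ι ⊕ (ι ⊕ ι)) := by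
  have sec : ∀ {u : (ι → ℝ) → ℝ} (i : ι → ι ⊕ ι), PolyBdd (fun x => ‖x‖) u →
      PolyBdd (fun ω => ‖ω‖) fun ω => u (mix i θ ω) :=
    fun i hu => (hu.comp_mix i).section_right θ
  have hu := (sec j (hφ.poly_d p)).mul (sec j' hψ.poly)
  have hA := (sec j (hφ.poly_dd p)).mul (sec j' hψ.poly)
  have hB := (sec j (hφ.poly_d p)).mul (sec j' (hψ.poly_d p))
  have hc : ∀ k, PolyBdd (fun ω : ι ⊕ (ι ⊕ ι) → ℝ => ‖ω‖) fun ω => ω k := fun k =>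
    PolyBdd.of_linear (by fun_prop) 1 fun ω => by
      have := norm_le_pi_norm ω k
      simp only [Real.norm_eq_abs] at this
      simp only [abs_norm]
      linarith
  have h1 := integral_coord_mul_stdPi (Sum.inl p) hu ((PolyBdd.const (sin θ)).mul (hA.add hB))
    fun ω => by
      have e1 := (hφ.hasLineDerivAt p (mix j θ ω)).hasDerivAt_scale (sin θ)
      have e2 := (hψ.hasLineDerivAt_self p (mix j' θ ω)).hasDerivAt_scale (sin θ)
      have e3 := e1.mul e2
      unfold HasLineDerivAt
      simp only [mix_add_inl]
      convert! e3 using 1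
      simp; ring
  have h2 := integral_coord_mul_stdPi (Sum.inr (j p)) hu ((PolyBdd.const (cos θ)).mul hA)
    fun ω => by
      have e1 := (hφ.hasLineDerivAt p (mix j θ ω)).hasDerivAt_scale (cos θ)
      have e3 := e1.mul_const (ψ (mix j' θ ω))
      unfold HasLineDerivAt
      simp only [mix_add_inr j hj, mix_add_inr_of_ne j j' hjj]
      convert! e3 using 1
      ring
  have i1 := ((hc (Sum.inl p)).mul hu).integrable (μ := stdPi (ι ⊕ (ι ⊕ ι)))
  have i2 := ((hc (Sum.inr (j p))).mul hu).integrable (μ := stdPi (ι ⊕ (ι ⊕ ι)))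
  have iA := hA.integrable (μ := stdPi (ι ⊕ (ι ⊕ ι)))
  have iB := hB.integrable (μ := stdPi (ι ⊕ (ι ⊕ ι)))
  rw [integral_const_mul, integral_add iA iB] at h1
  rw [integral_const_mul] at h2
  simp only [sub_mul, mul_assoc]
  rw [integral_sub (i1.const_mul _) (i2.const_mul _), integral_const_mul, integral_const_mul,
    h1, h2]
  ring

/-- The derivative of the Gaussian interpolation between `E[φ] E[ψ]` and `E[φ ψ]`. -/
theorem hasDerivAt_integral_mix (hφ : PolySmooth φ dφ ddφ) (hψ : PolySmooth ψ dψ ddψ) (θ : ℝ) :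
    HasDerivAt (fun θ => ∫ ω, φ (mix Sum.inl θ ω) * ψ (mix Sum.inr θ ω)
        ∂stdPi (ι ⊕ (ι ⊕ ι)))
      (2 * sin θ * cos θ * ∑ p, ∫ ω, dφ p (mix Sum.inl θ ω) * dψ p (mix Sum.inr θ ω)
        ∂stdPi (ι ⊕ (ι ⊕ ι))) θ := by
  have hF : PolyBdd (fun q : ℝ × (ι ⊕ (ι ⊕ ι) → ℝ) => ‖q.2‖)
      fun q => φ (mix Sum.inl q.1 q.2) * ψ (mix Sum.inr q.1 q.2) :=
    (hφ.poly.comp_mix _).mul (hψ.poly.comp_mix _)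
  have hA : ∀ p, PolyBdd (fun q : ℝ × (ι ⊕ (ι ⊕ ι) → ℝ) => ‖q.2‖) fun q =>
      (cos q.1 * q.2 (Sum.inl p) - sin q.1 * q.2 (Sum.inr (Sum.inl p))) *
        (dφ p (mix Sum.inl q.1 q.2) * ψ (mix Sum.inr q.1 q.2)) := fun p =>
    (polyBdd_rotated_coord Sum.inl p).mul (((hφ.poly_d p).comp_mix _).mul (hψ.poly.comp_mix _))
  have hB : ∀ p, PolyBdd (fun q : ℝ × (ι ⊕ (ι ⊕ ι) → ℝ) => ‖q.2‖) fun q =>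
      (cos q.1 * q.2 (Sum.inl p) - sin q.1 * q.2 (Sum.inr (Sum.inr p))) *
        (dψ p (mix Sum.inr q.1 q.2) * φ (mix Sum.inl q.1 q.2)) := fun p =>
    (polyBdd_rotated_coord Sum.inr p).mul (((hψ.poly_d p).comp_mix _).mul (hφ.poly.comp_mix _))
  have hS := PolyBdd.sum Finset.univ fun p _ => (hA p).add (hB p)
  have hmix : ∀ (j : ι → ι ⊕ ι) (θ : ℝ) (ω : ι ⊕ (ι ⊕ ι) → ℝ), HasDerivAt (fun θ => mix j θ ω)
      (fun p => cos θ * ω (Sum.inl p) - sin θ * ω (Sum.inr (j p))) θ := by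
    intro j θ ω
    refine hasDerivAt_pi.2 fun p => ?_
    convert! ((hasDerivAt_sin θ).mul_const (ω (Sum.inl p))).add
      ((hasDerivAt_cos θ).mul_const (ω (Sum.inr (j p)))) using 1
    ring
  have hS' := hS
  obtain ⟨cS, C, k, hC, hk⟩ := hS'
  have hb : PolyBdd (fun x : ι ⊕ (ι ⊕ ι) → ℝ => ‖x‖) fun x => C * (1 + ‖x‖) ^ k :=
    ⟨by fun_prop, C, k, hC, fun x => by
      rw [abs_of_nonneg (by positivity), abs_of_nonneg (norm_nonneg x)]⟩
  have key := (hasDerivAt_integral_of_dominated_loc_of_deriv_le (μ := stdPi (ι ⊕ (ι ⊕ ι)))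
    (F := fun θ ω => φ (mix Sum.inl θ ω) * ψ (mix Sum.inr θ ω)) (x₀ := θ) (s := Set.univ)
    (F' := fun θ ω => ∑ p, ((cos θ * ω (Sum.inl p) - sin θ * ω (Sum.inr (Sum.inl p))) *
        (dφ p (mix Sum.inl θ ω) * ψ (mix Sum.inr θ ω)) +
        (cos θ * ω (Sum.inl p) - sin θ * ω (Sum.inr (Sum.inr p))) *
        (dψ p (mix Sum.inr θ ω) * φ (mix Sum.inl θ ω))))
    (bound := fun x => C * (1 + ‖x‖) ^ k) univ_mem
    (Eventually.of_forall fun θ => (hF.section_right θ).1.aestronglyMeasurable)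
    (hF.section_right θ).integrable (hS.section_right θ).1.aestronglyMeasurable
    (ae_of_all _ fun ω θ _ => by simpa using hk (θ, ω)) hb.integrable
    (ae_of_all _ fun ω θ _ => by
      have e1 := (hφ.hasFDerivAt (mix Sum.inl θ ω)).comp_hasDerivAt θ (hmix Sum.inl θ ω)
      have e2 := (hψ.hasFDerivAt (mix Sum.inr θ ω)).comp_hasDerivAt θ (hmix Sum.inr θ ω)
      convert! e1.mul e2 using 1
      simp only [_root_.sum_apply, smul_apply,
        ContinuousLinearMap.proj_apply, smul_eq_mul, Finset.sum_mul, Finset.mul_sum,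
        ← Finset.sum_add_distrib, Function.comp]
      refine Finset.sum_congr rfl fun p _ => ?_
      ring)).2
  convert! key using 1
  rw [integral_finsetSum _ fun p _ => (((hA p).add (hB p)).section_right θ).integrable,
    Finset.mul_sum]
  refine Finset.sum_congr rfl fun p _ => ?_
  rw [integral_add ((hA p).section_right θ).integrable ((hB p).section_right θ).integrable,
    integral_rotated_coord_mul hφ hψ Sum.inl_injective (fun _ _ => Sum.inr_ne_inl) θ p,
    integral_rotated_coord_mul hψ hφ Sum.inr_injective (fun _ _ => Sum.inl_ne_inr) θ p]
  simp only [mul_comm (dψ p _)]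
  ring

end Interpolation

section SteinBound

variable {ι : Type*} [Fintype ι]

theorem integral_stdPi_blocks (G : (ι → ℝ) × (ι → ℝ) × (ι → ℝ) → ℝ) :
    ∫ ω, G (fun p => ω (Sum.inl p), fun p => ω (Sum.inr (Sum.inl p)),
        fun p => ω (Sum.inr (Sum.inr p))) ∂stdPi (ι ⊕ (ι ⊕ ι)) =
      ∫ z, G z ∂(stdPi ι).prod ((stdPi ι).prod (stdPi ι)) := by
  have h1 := measurePreserving_sumPiEquivProdPi (fun _ : ι ⊕ (ι ⊕ ι) => gaussianReal 0 1)
  have h2 := measurePreserving_sumPiEquivProdPi (fun _ : ι ⊕ ι => gaussianReal 0 1)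
  have h3 := (MeasurePreserving.id (stdPi ι)).prod h2
  have e1 := h3.integral_comp
    ((MeasurableEquiv.refl (ι → ℝ)).prodCongr
      (MeasurableEquiv.sumPiEquivProdPi fun _ : ι ⊕ ι => ℝ)).measurableEmbedding G
  rw [← e1]
  exact h1.integral_comp
    (MeasurableEquiv.sumPiEquivProdPi fun _ : ι ⊕ (ι ⊕ ι) => ℝ).measurableEmbedding
    (fun z => G (Prod.map id (MeasurableEquiv.sumPiEquivProdPi fun _ : ι ⊕ ι => ℝ) z))

theorem integral_stdPi_fst (u : (ι → ℝ) → ℝ) :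
    ∫ ω, u (fun p => ω (Sum.inl p)) ∂stdPi (ι ⊕ (ι ⊕ ι)) = ∫ x, u x ∂stdPi ι := by
  rw [integral_stdPi_blocks (fun z => u z.1), integral_fun_fst]
  simp

theorem integral_stdPi_mul (u v : (ι → ℝ) → ℝ) :
    ∫ ω, u (fun p => ω (Sum.inr (Sum.inl p))) * v (fun p => ω (Sum.inr (Sum.inr p)))
        ∂stdPi (ι ⊕ (ι ⊕ ι)) = (∫ x, u x ∂stdPi ι) * ∫ x, v x ∂stdPi ι := by
  rw [integral_stdPi_blocks (fun z => u z.2.1 * v z.2.2),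
    integral_fun_snd (f := fun z : (ι → ℝ) × (ι → ℝ) => u z.1 * v z.2), integral_prod_mul]
  simp

variable [DecidableEq ι] {φ ψ : (ι → ℝ) → ℝ} {dφ ddφ dψ ddψ : ι → (ι → ℝ) → ℝ}

/-- The covariance formula for functions of a Gaussian vector. -/
theorem integral_mul_sub_mul_integral (hφ : PolySmooth φ dφ ddφ) (hψ : PolySmooth ψ dψ ddψ) :
    (∫ x, φ x * ψ x ∂stdPi ι) - (∫ x, φ x ∂stdPi ι) * ∫ x, ψ x ∂stdPi ι =
      ∫ θ in (0 : ℝ)..(π / 2), 2 * sin θ * cos θ *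
        ∑ p, ∫ ω, dφ p (mix Sum.inl θ ω) * dψ p (mix Sum.inr θ ω) ∂stdPi (ι ⊕ (ι ⊕ ι)) := by
  have hc : Continuous fun θ : ℝ => 2 * sin θ * cos θ *
      ∑ p, ∫ ω, dφ p (mix Sum.inl θ ω) * dψ p (mix Sum.inr θ ω) ∂stdPi (ι ⊕ (ι ⊕ ι)) := by
    refine Continuous.mul (by fun_prop) (continuous_finsetSum _ fun p _ => ?_)
    exact (((hφ.poly_d p).comp_mix _).mul ((hψ.poly_d p).comp_mix _)).continuous_integral
  rw [intervalIntegral.integral_eq_sub_of_hasDerivAt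
    (fun θ _ => hasDerivAt_integral_mix hφ hψ θ) (hc.intervalIntegrable _ _)]
  congr 1
  · rw [← integral_stdPi_fst fun x => φ x * ψ x]
    simp only [mix_pi_div_two]
  · rw [← integral_stdPi_mul φ ψ]
    simp only [mix_zero]

/-- The interpolated Gaussian vector is standard Gaussian at every angle. -/
theorem integral_mix_eq (hφ : PolySmooth φ dφ ddφ) (θ : ℝ) :
    ∫ ω, φ (mix Sum.inl θ ω) ∂stdPi (ι ⊕ (ι ⊕ ι)) = ∫ x, φ x ∂stdPi ι := by
  have h := fun θ => hasDerivAt_integral_mix hφ (PolySmooth.const (ι := ι) 1) θ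
  simp only [mul_one, mul_zero, integral_zero, Finset.sum_const_zero] at h
  rw [is_const_of_deriv_eq_zero (fun θ => (h θ).differentiableAt) (fun θ => (h θ).deriv)
    θ (π / 2), ← integral_stdPi_fst φ]
  simp only [mix_pi_div_two]

/-- Composition of a polynomially bounded `C²` function of one variable with an affine image of
a function of linear growth. -/
theorem PolySmooth.comp_affine (hφ : PolySmooth φ dφ ddφ) {K : ℝ}
    (hK : ∀ x, |φ x| ≤ K * (1 + ‖x‖)) {f f₁ f₂ : ℝ → ℝ}
    (hf : PolyBdd (fun y => ‖y‖) f) (hf₁ : PolyBdd (fun y => ‖y‖) f₁)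
    (hf₂ : PolyBdd (fun y => ‖y‖) f₂) (h₁ : ∀ y, HasDerivAt f (f₁ y) y)
    (h₂ : ∀ y, HasDerivAt f₁ (f₂ y) y) (m r : ℝ) :
    PolySmooth (fun x => f ((φ x - m) / r)) (fun p x => f₁ ((φ x - m) / r) * (dφ p x / r))
      (fun p x => f₂ ((φ x - m) / r) * (dφ p x / r) * (dφ p x / r) +
        f₁ ((φ x - m) / r) * (ddφ p x / r)) := by
  have hc : Continuous fun x => (φ x - m) / r := (hφ.poly.1.sub continuous_const).div_const r
  have hb : ∀ x, |‖(φ x - m) / r‖| ≤ ((K + |m|) / |r|) * (1 + |‖x‖|) := by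
    intro x
    rw [abs_norm, abs_norm, norm_div, div_mul_eq_mul_div]
    simp only [Real.norm_eq_abs]
    gcongr
    have := abs_sub (φ x) m
    nlinarith [hK x, norm_nonneg x, abs_nonneg m]
  have comp : ∀ {g : ℝ → ℝ}, PolyBdd (fun y => ‖y‖) g →
      PolyBdd (fun x => ‖x‖) fun x => g ((φ x - m) / r) := fun hg => hg.comp hc _ hb
  have hdiv : ∀ {u : (ι → ℝ) → ℝ}, PolyBdd (fun x => ‖x‖) u →
      PolyBdd (fun x => ‖x‖) fun x => u x / r := fun hu => by
    simpa [div_eq_mul_inv] using hu.mul (PolyBdd.const r⁻¹)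
  refine ⟨fun x => ?_, fun p x => ?_, comp hf, fun p => (comp hf₁).mul (hdiv (hφ.poly_d p)),
    fun p => (((comp hf₂).mul (hdiv (hφ.poly_d p))).mul (hdiv (hφ.poly_d p))).add
      ((comp hf₁).mul (hdiv (hφ.poly_dd p)))⟩
  · have e := (h₁ ((φ x - m) / r)).comp_hasFDerivAt x
      (((hφ.hasFDerivAt x).sub_const m).mul_const r⁻¹)
    convert! e using 1
    simp only [Finset.smul_sum, smul_smul]
    refine Finset.sum_congr rfl fun p _ => ?_
    congr 1
    ring
  · have e0 : HasDerivAt (fun t : ℝ => (φ (x + t • Pi.single p 1) - m) / r) (dφ p x / r) 0 :=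
      (HasDerivAt.sub_const m (hφ.hasLineDerivAt_self p x)).div_const r
    have e1 : HasDerivAt (fun t : ℝ => f₁ ((φ (x + t • Pi.single p 1) - m) / r))
        (f₂ ((φ x - m) / r) * (dφ p x / r)) 0 := by
      refine HasDerivAt.comp (0 : ℝ) (h₂ := f₁) ?_ e0
      simpa using h₂ ((φ x - m) / r)
    have e2 : HasDerivAt (fun t : ℝ => dφ p (x + t • Pi.single p 1) / r) (ddφ p x / r) 0 :=
      HasDerivAt.div_const (hφ.hasLineDerivAt p x) r
    have e3 := e1.mul e2
    unfold HasLineDerivAt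
    convert! e3 using 1
    simp

/-- Bound on Stein's operator applied to a normalised function `F` of a Gaussian vector. -/
theorem abs_integral_stein_le {F : (ι → ℝ) → ℝ} {dF ddF : ι → (ι → ℝ) → ℝ}
    (hF : PolySmooth F dF ddF) {K : ℝ} (hK : ∀ x, |F x| ≤ K * (1 + ‖x‖))
    {f f₁ f₂ f₃ : ℝ → ℝ}
    (hf : PolyBdd (fun y => ‖y‖) f) (hf₁ : PolyBdd (fun y => ‖y‖) f₁)
    (hf₂ : PolyBdd (fun y => ‖y‖) f₂) (hf₃ : PolyBdd (fun y => ‖y‖) f₃)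
    (h₁ : ∀ y, HasDerivAt f (f₁ y) y) (h₂ : ∀ y, HasDerivAt f₁ (f₂ y) y)
    (h₃ : ∀ y, HasDerivAt f₂ (f₃ y) y) (hle : ∀ y, |f₁ y| ≤ 2) {ν : ℝ} (hν : 0 < ν)
    {q : ℝ → ℝ} (hq : Continuous q) {B : ℝ} (hqB : ∀ θ, |q θ| ≤ B)
    (hqν : ∫ θ in (0 : ℝ)..(π / 2), 2 * sin θ * cos θ * q θ = ν) :
    |∫ x, (f₁ ((F x - ∫ y, F y ∂stdPi ι) / √ν) - (F x - ∫ y, F y ∂stdPi ι) / √ν *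
        f ((F x - ∫ y, F y ∂stdPi ι) / √ν)) ∂stdPi ι| ≤
      2 / ν * ∫ θ in (0 : ℝ)..(π / 2), 2 * sin θ * cos θ *
        ∫ ω, |(∑ p, dF p (mix Sum.inl θ ω) * dF p (mix Sum.inr θ ω)) - q θ|
          ∂stdPi (ι ⊕ (ι ⊕ ι)) := by
  set m := ∫ y, F y ∂stdPi ι with hm
  set P := stdPi (ι ⊕ (ι ⊕ ι)) with hP
  have hr : 0 < √ν := Real.sqrt_pos.2 hν
  have hrr : √ν * √ν = ν := Real.mul_self_sqrt hν.le
  have s0 := hF.comp_affine hK hf hf₁ hf₂ h₁ h₂ m (√ν)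
  have s1 := hF.comp_affine hK hf₁ hf₂ hf₃ h₂ h₃ m (√ν)
  have cov := integral_mul_sub_mul_integral s0 hF
  have hQ : PolyBdd (fun z : ℝ × (ι ⊕ (ι ⊕ ι) → ℝ) => ‖z.2‖)
      fun z => ∑ p, dF p (mix Sum.inl z.1 z.2) * dF p (mix Sum.inr z.1 z.2) :=
    PolyBdd.sum _ fun p _ => ((hF.poly_d p).comp_mix _).mul ((hF.poly_d p).comp_mix _)
  have hg : PolyBdd (fun z : ℝ × (ι ⊕ (ι ⊕ ι) → ℝ) => ‖z.2‖)
      fun z => f₁ ((F (mix Sum.inl z.1 z.2) - m) / √ν) := s1.poly.comp_mix _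
  have hgQ := hg.mul hQ
  have e1 : ∫ x, (F x - m) / √ν * f ((F x - m) / √ν) ∂stdPi ι =
      ν⁻¹ * ∫ θ in (0 : ℝ)..(π / 2), 2 * sin θ * cos θ *
        ∫ ω, f₁ ((F (mix Sum.inl θ ω) - m) / √ν) *
          ∑ p, dF p (mix Sum.inl θ ω) * dF p (mix Sum.inr θ ω) ∂P := by
    have a1 : ∫ x, (F x - m) / √ν * f ((F x - m) / √ν) ∂stdPi ι =
        (√ν)⁻¹ * ((∫ x, f ((F x - m) / √ν) * F x ∂stdPi ι) -
          (∫ x, f ((F x - m) / √ν) ∂stdPi ι) * m) := by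
      rw [← integral_mul_const, ← integral_sub (s0.poly.mul hF.poly).integrable
        (s0.poly.mul (PolyBdd.const m)).integrable, ← integral_const_mul]
      congr 1; ext x; ring
    rw [a1, cov, ← intervalIntegral.integral_const_mul, ← intervalIntegral.integral_const_mul]
    congr 1
    ext θ
    rw [← integral_finsetSum _ fun p _ =>
      ((((s0.poly_d p).comp_mix Sum.inl).mul ((hF.poly_d p).comp_mix Sum.inr)).section_right
        θ).integrable]
    have a2 : ∀ ω, (∑ p, f₁ ((F (mix Sum.inl θ ω) - m) / √ν) * (dF p (mix Sum.inl θ ω) / √ν) *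
        dF p (mix Sum.inr θ ω)) = (√ν)⁻¹ * (f₁ ((F (mix Sum.inl θ ω) - m) / √ν) *
          ∑ p, dF p (mix Sum.inl θ ω) * dF p (mix Sum.inr θ ω)) := by
      intro ω
      rw [Finset.mul_sum, Finset.mul_sum]
      refine Finset.sum_congr rfl fun p _ => ?_
      ring
    simp only [a2]
    rw [integral_const_mul]
    have a3 : ν⁻¹ = (√ν)⁻¹ * (√ν)⁻¹ := by rw [← mul_inv, hrr]
    rw [a3]
    ring
  have e2 : ∫ x, f₁ ((F x - m) / √ν) ∂stdPi ι =
      ν⁻¹ * ∫ θ in (0 : ℝ)..(π / 2), 2 * sin θ * cos θ *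
        ∫ ω, f₁ ((F (mix Sum.inl θ ω) - m) / √ν) * q θ ∂P := by
    have a1 : ∀ θ, 2 * sin θ * cos θ * ∫ ω, f₁ ((F (mix Sum.inl θ ω) - m) / √ν) * q θ ∂P =
        2 * sin θ * cos θ * q θ * ∫ x, f₁ ((F x - m) / √ν) ∂stdPi ι := by
      intro θ
      rw [integral_mul_const, integral_mix_eq s1 θ]
      ring
    simp only [a1]
    rw [intervalIntegral.integral_mul_const, hqν, ← mul_assoc, inv_mul_cancel₀ hν.ne', one_mul]
  have hq' : PolyBdd (fun z : ℝ × (ι ⊕ (ι ⊕ ι) → ℝ) => ‖z.2‖) fun z => q z.1 :=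
    PolyBdd.of_bounded (by fun_prop) B fun z => hqB _
  have hgq := hg.mul hq'
  have hd := (hQ.sub hq').abs
  have i1 : IntervalIntegrable (fun θ => 2 * sin θ * cos θ *
      ∫ ω, f₁ ((F (mix Sum.inl θ ω) - m) / √ν) * q θ ∂P) volume 0 (π / 2) :=
    Continuous.intervalIntegrable (Continuous.mul (by fun_prop) hgq.continuous_integral) _ _
  have i2 : IntervalIntegrable (fun θ => 2 * sin θ * cos θ *
      ∫ ω, f₁ ((F (mix Sum.inl θ ω) - m) / √ν) *
          ∑ p, dF p (mix Sum.inl θ ω) * dF p (mix Sum.inr θ ω) ∂P) volume 0 (π / 2) :=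
    Continuous.intervalIntegrable (Continuous.mul (by fun_prop) hgQ.continuous_integral) _ _
  have hsc : Continuous fun θ : ℝ => 2 * sin θ * cos θ := by fun_prop
  rw [integral_sub s1.poly.integrable
    ((((hF.poly.sub (PolyBdd.const m)).mul (PolyBdd.const (√ν)⁻¹)).mul s0.poly).integrable.congr
      (ae_of_all _ fun x => by simp [div_eq_mul_inv])), e1, e2, ← mul_sub,
    ← intervalIntegral.integral_sub i1 i2, abs_mul,
    abs_of_pos (inv_pos.2 hν), div_eq_mul_inv 2 ν, mul_comm (2 : ℝ) ν⁻¹, mul_assoc]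
  refine mul_le_mul_of_nonneg_left ?_ (inv_pos.2 hν).le
  rw [← intervalIntegral.integral_const_mul, ← Real.norm_eq_abs]
  refine intervalIntegral.norm_integral_le_of_norm_le (by positivity)
    (ae_of_all _ fun θ hθ => ?_)
    ((continuous_const.mul (hsc.mul (hd.continuous_integral (μ := P)))).intervalIntegrable _ _)
  have hs : 0 ≤ sin θ := sin_nonneg_of_nonneg_of_le_pi hθ.1.le (by linarith [hθ.2, pi_pos])
  have hcos : 0 ≤ cos θ := cos_nonneg_of_mem_Icc ⟨by linarith [hθ.1, pi_pos], hθ.2⟩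
  rw [← mul_sub, ← integral_sub (hgq.section_right θ).integrable
    (hgQ.section_right θ).integrable, norm_mul, Real.norm_of_nonneg (by positivity),
    mul_left_comm 2]
  refine mul_le_mul_of_nonneg_left ?_ (by positivity)
  rw [← integral_const_mul]
  refine norm_integral_le_of_norm_le ((hd.section_right θ).integrable.const_mul 2)
    (ae_of_all _ fun ω => ?_)
  rw [← mul_sub, norm_mul, ← abs_neg, neg_sub]
  exact mul_le_mul_of_nonneg_right (hle _) (abs_nonneg _)

end SteinBound

/-! ### Stein's equation -/

section SteinEquation

theorem integrable_exp_neg_sq_div_two : Integrable fun y : ℝ => exp (-(y ^ 2 / 2)) := by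
  have := integrable_exp_neg_mul_sq (b := 1 / 2) (by norm_num)
  refine this.congr (ae_of_all _ fun y => ?_)
  simp only
  congr 1
  ring

/-- Mills' bound on the Gaussian tail. -/
theorem mul_integral_Ioi_exp_le {x : ℝ} (hx : 0 ≤ x) :
    x * ∫ y in Set.Ioi x, exp (-(y ^ 2 / 2)) ≤ exp (-(x ^ 2 / 2)) := by
  have hd : ∀ y : ℝ, HasDerivAt (fun y : ℝ => -exp (-(y ^ 2 / 2))) (y * exp (-(y ^ 2 / 2))) y := by
    intro y
    convert! (((hasDerivAt_pow 2 y).div_const 2).neg.exp).neg using 1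
    simp; ring
  have ht : Tendsto (fun y : ℝ => -exp (-(y ^ 2 / 2))) atTop (nhds 0) := by
    rw [← neg_zero]
    refine (tendsto_exp_neg_atTop_nhds_zero.comp ?_).neg
    exact (tendsto_pow_atTop (by norm_num)).atTop_div_const (by norm_num)
  have hpos : ∀ y ∈ Set.Ioi x, 0 ≤ y * exp (-(y ^ 2 / 2)) := fun y hy =>
    mul_nonneg (hx.trans (le_of_lt hy)) (exp_pos _).le
  have h1 := integral_Ioi_of_hasDerivAt_of_nonneg' (a := x) (fun y _ => hd y) hpos ht
  have h2 := integrableOn_Ioi_deriv_of_nonneg' (a := x) (fun y _ => hd y) hpos ht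
  rw [zero_sub, neg_neg] at h1
  rw [← h1, ← integral_const_mul]
  exact setIntegral_mono_on (integrable_exp_neg_sq_div_two.integrableOn.const_mul x) h2
    measurableSet_Ioi fun y hy => mul_le_mul_of_nonneg_right (le_of_lt hy) (exp_pos _).le

theorem mul_integral_Iic_exp_le {x : ℝ} (hx : x ≤ 0) :
    -x * ∫ y in Set.Iic x, exp (-(y ^ 2 / 2)) ≤ exp (-(x ^ 2 / 2)) := by
  have h := mul_integral_Ioi_exp_le (neg_nonneg.2 hx)
  rw [← integral_comp_neg_Iic] at h
  simpa using h

/-- For a test function `h` with values in `[0, 1]`, Stein's equation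
`f' - x f = h - E h` has a smooth solution with `|f'| ≤ 2`. -/
theorem exists_stein_solution {h : ℝ → ℝ} (hh : ContDiff ℝ 2 h) (hs : HasCompactSupport h)
    (h01 : ∀ x, h x ∈ Set.Icc (0 : ℝ) 1) :
    ∃ f f₁ f₂ f₃ : ℝ → ℝ, PolyBdd (fun y => ‖y‖) f ∧ PolyBdd (fun y => ‖y‖) f₁ ∧
      PolyBdd (fun y => ‖y‖) f₂ ∧ PolyBdd (fun y => ‖y‖) f₃ ∧
      (∀ y, HasDerivAt f (f₁ y) y) ∧ (∀ y, HasDerivAt f₁ (f₂ y) y) ∧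
      (∀ y, HasDerivAt f₂ (f₃ y) y) ∧ (∀ y, |f₁ y| ≤ 2) ∧
      ∀ y, f₁ y - y * f y = h y - ∫ z, h z ∂gaussianReal 0 1 := by
  set a := ∫ z, h z ∂gaussianReal 0 1 with ha
  set p : ℝ → ℝ := fun y => exp (-(y ^ 2 / 2)) with hp
  have hpi : Integrable p := integrable_exp_neg_sq_div_two
  have hhi : Integrable h (gaussianReal 0 1) :=
    (PolyBdd.of_bounded (m := fun y : ℝ => ‖y‖) hh.continuous 1 fun x =>
      abs_le.2 ⟨by linarith [(h01 x).1], (h01 x).2⟩).integrable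
  have ha01 : a ∈ Set.Icc (0 : ℝ) 1 := by
    refine ⟨integral_nonneg fun x => (h01 x).1, ?_⟩
    have := integral_mono hhi (integrable_const (1 : ℝ)) fun x => (h01 x).2
    simpa using this
  have hb : ∀ x, |h x - a| ≤ 1 := fun x =>
    abs_le.2 ⟨by linarith [(h01 x).1, ha01.2], by linarith [(h01 x).2, ha01.1]⟩
  have hpc : Continuous p := by simp only [hp]; fun_prop
  have hkc : Continuous fun y => (h y - a) * p y := (hh.continuous.sub continuous_const).mul hpc
  have hkb : ∀ y, ‖(h y - a) * p y‖ ≤ p y := fun y => by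
    rw [norm_mul, Real.norm_of_nonneg (exp_pos _).le]
    exact mul_le_of_le_one_left (exp_pos _).le (hb y)
  have hki : Integrable fun y => (h y - a) * p y :=
    hpi.mono' hkc.aestronglyMeasurable (ae_of_all _ hkb)
  have hk0 : ∫ y, (h y - a) * p y = 0 := by
    have e : ∫ y, (h y - a) ∂gaussianReal 0 1 = 0 := by
      rw [integral_sub hhi (integrable_const a)]; simp [ha]
    rw [integral_gaussianReal_eq_integral_smul one_ne_zero] at e
    have e' : ∀ y, gaussianPDFReal 0 1 y • (h y - a) = (√(2 * π))⁻¹ * ((h y - a) * p y) := by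
      intro y
      simp only [gaussianPDFReal, hp, smul_eq_mul, NNReal.coe_one, mul_one, sub_zero]
      rw [neg_div]
      ring
    simp only [e'] at e
    rw [integral_const_mul] at e
    exact (mul_eq_zero.1 e).resolve_left (by positivity)
  set J : ℝ → ℝ := fun x => ∫ y in Set.Iic x, (h y - a) * p y with hJ
  have hJd : ∀ x, HasDerivAt J ((h x - a) * p x) x := by
    intro x
    have e : J = fun x => (∫ y in (0 : ℝ)..x, (h y - a) * p y) + J 0 := by
      ext z
      rw [← intervalIntegral.integral_Iic_sub_Iic hki.integrableOn hki.integrableOn]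
      simp [hJ]
    rw [e]
    exact (intervalIntegral.integral_hasDerivAt_right (hkc.intervalIntegrable _ _)
      (hkc.stronglyMeasurableAtFilter _ _) hkc.continuousAt).add_const _
  have hJ1 : ∀ x, |J x| ≤ ∫ y in Set.Iic x, p y := fun x =>
    norm_integral_le_of_norm_le hpi.integrableOn (ae_of_all _ hkb)
  have hJ2 : ∀ x, |J x| ≤ ∫ y in Set.Ioi x, p y := fun x => by
    have e := intervalIntegral.integral_Iic_add_Ioi (b := x) hki.integrableOn hki.integrableOn
    rw [hk0] at e
    have e' : J x = -∫ y in Set.Ioi x, (h y - a) * p y := by simp only [hJ]; linarith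
    rw [e', abs_neg]
    exact norm_integral_le_of_norm_le hpi.integrableOn (ae_of_all _ hkb)
  set f : ℝ → ℝ := fun x => exp (x ^ 2 / 2) * J x with hf
  have hee : ∀ x : ℝ, exp (x ^ 2 / 2) * p x = 1 := fun x => by
    rw [hp, ← exp_add]; simp
  have hxf : ∀ x, |x * f x| ≤ 1 := by
    intro x
    have e : |x * f x| = exp (x ^ 2 / 2) * (|x| * |J x|) := by
      rw [hf, abs_mul, abs_mul, abs_exp]; ring
    rw [e, ← hee x]
    refine mul_le_mul_of_nonneg_left ?_ (exp_pos _).le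
    rcases le_total 0 x with hx | hx
    · rw [abs_of_nonneg hx]
      exact (mul_le_mul_of_nonneg_left (hJ2 x) hx).trans (mul_integral_Ioi_exp_le hx)
    · rw [abs_of_nonpos hx]
      exact (mul_le_mul_of_nonneg_left (hJ1 x) (neg_nonneg.2 hx)).trans
        (mul_integral_Iic_exp_le hx)
  have hfd : ∀ x, HasDerivAt f (x * f x + (h x - a)) x := by
    intro x
    have e := (((hasDerivAt_pow 2 x).div_const 2).exp).mul (hJd x)
    convert! e using 1
    have := hee x
    simp only [hf]
    norm_num
    linear_combination (-(h x - a)) * this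
  have hfc : Continuous f := continuous_iff_continuousAt.2 fun x => (hfd x).continuousAt
  obtain ⟨M, hM⟩ := isCompact_Icc.exists_bound_of_continuousOn
    (hfc.continuousOn (s := Set.Icc (-1) 1))
  have hfb : PolyBdd (fun y => ‖y‖) f := by
    refine PolyBdd.of_bounded hfc (max M 1) fun x => ?_
    rcases le_or_gt |x| 1 with hx | hx
    · exact (hM x (abs_le.1 hx)).trans (le_max_left _ _)
    · refine le_trans ?_ (le_max_right _ _)
      have := hxf x
      rw [abs_mul] at this
      nlinarith [abs_nonneg (f x)]
  have hid : PolyBdd (fun y : ℝ => ‖y‖) fun y => y :=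
    PolyBdd.of_linear continuous_id 1 fun x => by
      rw [abs_norm, Real.norm_eq_abs]; linarith
  have bdd : ∀ {u : ℝ → ℝ}, Continuous u → HasCompactSupport u → PolyBdd (fun y => ‖y‖) u := by
    intro u hu hus
    obtain ⟨C, hC⟩ := hus.exists_bound_of_continuous hu
    exact PolyBdd.of_bounded hu C hC
  have hd1 : ContDiff ℝ 1 (deriv h) := by
    have : ContDiff ℝ (1 + 1) h := by norm_num; exact hh
    exact (contDiff_succ_iff_deriv.1 this).2.2
  have hh1 := bdd hd1.continuous hs.deriv
  have hh2 := bdd (hd1.continuous_deriv le_rfl) hs.deriv.deriv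
  have hhd : ∀ y, HasDerivAt h (deriv h y) y := fun y =>
    ((hh.differentiable (by norm_num)) y).hasDerivAt
  have hhd1 : ∀ y, HasDerivAt (deriv h) (deriv (deriv h) y) y := fun y =>
    ((hd1.differentiable (by norm_num)) y).hasDerivAt
  have hf1 := (hid.mul hfb).add ((bdd hh.continuous hs).sub (PolyBdd.const a))
  have hf2 := (hfb.add (hid.mul hf1)).add hh1
  have hfd1 : ∀ y, HasDerivAt (fun x => x * f x + (h x - a))
      (f y + y * (y * f y + (h y - a)) + deriv h y) y := fun y => by
    convert! ((hasDerivAt_id y).mul (hfd y)).add ((hhd y).sub_const a) using 1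
    simp
  have hfd2 : ∀ y, HasDerivAt (fun x => f x + x * (x * f x + (h x - a)) + deriv h x)
      ((y * f y + (h y - a)) + ((y * f y + (h y - a)) +
        y * (f y + y * (y * f y + (h y - a)) + deriv h y)) + deriv (deriv h) y) y := fun y => by
    convert! ((hfd y).add ((hasDerivAt_id y).mul (hfd1 y))).add (hhd1 y) using 1
    simp
  refine ⟨f, _, _, _, hfb, hf1, hf2, (hf1.add (hf1.add (hid.mul hf2))).add hh2, hfd, hfd1, hfd2,
    fun y => ?_, fun y => by ring⟩
  calc |y * f y + (h y - a)| ≤ |y * f y| + |h y - a| := abs_add_le _ _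
    _ ≤ 2 := by linarith [hxf y, hb y]

end SteinEquation

/-! ### From smooth test functions to measurable sets -/

section TotalVariation

theorem abs_integral_sub_real_le (μ : Measure ℝ) [IsFiniteMeasure μ] {A U K : Set ℝ}
    (hA : MeasurableSet A) (hU : MeasurableSet U) (hK : MeasurableSet K) (hKA : K ⊆ A)
    (hAU : A ⊆ U) {h : ℝ → ℝ} (hc : Continuous h) (h01 : ∀ x, h x ∈ Set.Icc (0 : ℝ) 1)
    (hone : ∀ x ∈ K, h x = 1) (hzero : ∀ x ∉ U, h x = 0) :
    |∫ x, h x ∂μ - μ.real A| ≤ μ.real (U \ K) := by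
  have hi : Integrable h μ := (integrable_const (1 : ℝ)).mono' hc.aestronglyMeasurable
    (ae_of_all _ fun x => by
      rw [Real.norm_of_nonneg (h01 x).1]; exact (h01 x).2)
  have hiA : Integrable (A.indicator fun _ => (1 : ℝ)) μ := (integrable_const 1).indicator hA
  have hiU : Integrable ((U \ K).indicator fun _ => (1 : ℝ)) μ :=
    (integrable_const 1).indicator (hU.diff hK)
  have eA := integral_indicator_const (μ := μ) (1 : ℝ) hA
  have eU := integral_indicator_const (μ := μ) (1 : ℝ) (hU.diff hK)
  rw [smul_eq_mul, mul_one] at eA eU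
  rw [← eA, ← eU, ← integral_sub hi hiA, ← Real.norm_eq_abs]
  refine norm_integral_le_of_norm_le hiU (ae_of_all _ fun x => ?_)
  rw [Real.norm_eq_abs]
  by_cases hxK : x ∈ K
  · simp [hxK, hKA hxK, hone x hxK]
  · by_cases hxU : x ∈ U
    · have e : (U \ K).indicator (fun _ => (1 : ℝ)) x = 1 := by simp [hxU, hxK]
      rw [e]
      by_cases hxA : x ∈ A
      · simp only [hxA, Set.indicator_of_mem]
        exact abs_le.2 ⟨by linarith [(h01 x).1], by linarith [(h01 x).2]⟩
      · simp only [hxA, not_false_eq_true, Set.indicator_of_notMem]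
        exact abs_le.2 ⟨by linarith [(h01 x).1], by linarith [(h01 x).2]⟩
    · have hxA : x ∉ A := fun hx => hxU (hAU hx)
      simp [hxA, hxU, hzero x hxU]

/-- Total variation is controlled by smooth compactly supported test functions. -/
theorem abs_real_sub_real_le (μ ν : Measure ℝ) [IsFiniteMeasure μ] [IsFiniteMeasure ν] {C : ℝ}
    (H : ∀ h : ℝ → ℝ, ContDiff ℝ 2 h → HasCompactSupport h →
      (∀ x, h x ∈ Set.Icc (0 : ℝ) 1) → |∫ x, h x ∂μ - ∫ x, h x ∂ν| ≤ C)
    {A : Set ℝ} (hA : MeasurableSet A) : |μ.real A - ν.real A| ≤ C := by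
  refine le_of_forall_pos_le_add fun ε hε => ?_
  have hε' : ENNReal.ofReal (ε / 2) ≠ 0 := by simpa using hε
  obtain ⟨K, hKA, hKc, hK⟩ := hA.exists_isCompact_sdiff_lt (measure_ne_top (μ + ν) A) hε'
  obtain ⟨U, hAU, hUo, -, hU⟩ := hA.exists_isOpen_sdiff_lt (measure_ne_top (μ + ν) A) hε'
  obtain ⟨h, hh, hr, hsupp, hone⟩ := exists_contMDiff_support_eq_eq_one_iff
    (modelWithCornersSelf ℝ ℝ) (n := 2) (s := U ∩ Metric.thickening 1 K) (t := K)
    (hUo.inter Metric.isOpen_thickening) hKc.isClosed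
    (Set.subset_inter (hKA.trans hAU) (Metric.self_subset_thickening one_pos K))
  have h01 : ∀ x, h x ∈ Set.Icc (0 : ℝ) 1 := fun x => hr ⟨x, rfl⟩
  have hcs : HasCompactSupport h := by
    refine HasCompactSupport.of_support_subset_isCompact
      (hKc.isBounded.thickening (δ := 1)).isCompact_closure ?_
    rw [hsupp]
    exact Set.inter_subset_right.trans subset_closure
  have hz : ∀ x ∉ U, h x = 0 := fun x hx => by
    rw [← Function.notMem_support, hsupp]
    exact fun h => hx h.1
  have key := H h hh.contDiff hcs h01
  have eμ := abs_integral_sub_real_le μ hA hUo.measurableSet hKc.measurableSet hKA hAU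
    hh.continuous h01 (fun x hx => (hone x).1 hx) hz
  have eν := abs_integral_sub_real_le ν hA hUo.measurableSet hKc.measurableSet hKA hAU
    hh.continuous h01 (fun x hx => (hone x).1 hx) hz
  have hsum : μ.real (U \ K) + ν.real (U \ K) ≤ ε := by
    rw [← measureReal_add_apply]
    have e1 : (μ + ν).real (U \ A) ≤ ε / 2 :=
      ENNReal.toReal_le_of_le_ofReal (by positivity) hU.le
    have e2 : (μ + ν).real (A \ K) ≤ ε / 2 :=
      ENNReal.toReal_le_of_le_ofReal (by positivity) hK.le
    have e3 : (μ + ν).real (U \ K) ≤ (μ + ν).real ((U \ A) ∪ (A \ K)) := by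
      refine measureReal_mono ?_
      intro x hx
      by_cases hxA : x ∈ A
      · exact Or.inr ⟨hxA, hx.2⟩
      · exact Or.inl ⟨hx.1, hxA⟩
    have e4 := measureReal_union_le (μ := μ + ν) (U \ A) (A \ K)
    linarith
  rw [abs_le] at *
  constructor <;> linarith [key.1, key.2, eμ.1, eμ.2, eν.1, eν.2]

end TotalVariation

/-! ### Log-partition functions -/

section LogPartition

variable {ι S : Type*} [Fintype ι] [Fintype S]

/-- The average of `a` under the Gibbs measure on `S` with energies `∑ p, c σ p * x p`. -/
def gibbsMean (c : S → ι → ℝ) (a : S → ℝ) (x : ι → ℝ) : ℝ :=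
  (∑ σ, a σ * exp (∑ p, c σ p * x p)) / ∑ σ, exp (∑ p, c σ p * x p)

variable [Nonempty S]

theorem sum_exp_pos (c : S → ι → ℝ) (x : ι → ℝ) : 0 < ∑ σ, exp (∑ p, c σ p * x p) :=
  Finset.sum_pos (fun _ _ => exp_pos _) Finset.univ_nonempty

theorem continuous_gibbsMean (c : S → ι → ℝ) (a : S → ℝ) : Continuous (gibbsMean c a) := by
  unfold gibbsMean
  exact Continuous.div (by fun_prop) (by fun_prop) fun x => (sum_exp_pos c x).ne'

theorem abs_gibbsMean_le (c : S → ι → ℝ) {a : S → ℝ} {M : ℝ} (ha : ∀ σ, |a σ| ≤ M)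
    (x : ι → ℝ) : |gibbsMean c a x| ≤ M := by
  rw [gibbsMean, abs_div, abs_of_pos (sum_exp_pos c x), div_le_iff₀ (sum_exp_pos c x),
    Finset.mul_sum]
  refine (Finset.abs_sum_le_sum_abs _ _).trans (Finset.sum_le_sum fun σ _ => ?_)
  rw [abs_mul, abs_exp]
  exact mul_le_mul_of_nonneg_right (ha σ) (exp_pos _).le

theorem polyBdd_gibbsMean (c : S → ι → ℝ) (a : S → ℝ) :
    PolyBdd (fun x => ‖x‖) (gibbsMean c a) :=
  PolyBdd.of_bounded (continuous_gibbsMean c a) (∑ σ, |a σ|) <|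
    abs_gibbsMean_le c fun σ => Finset.single_le_sum (f := fun σ => |a σ|)
      (fun _ _ => abs_nonneg _) (Finset.mem_univ σ)

/-- The log-partition function has linear growth. -/
theorem abs_log_sum_exp_le (c : S → ι → ℝ) :
    ∃ K, ∀ x : ι → ℝ, |log (∑ σ, exp (∑ p, c σ p * x p))| ≤ K * (1 + ‖x‖) := by
  set M := ∑ σ, ∑ p, |c σ p| with hM
  have hM0 : 0 ≤ M := Finset.sum_nonneg fun σ _ => Finset.sum_nonneg fun p _ => abs_nonneg _
  have hL : ∀ σ (x : ι → ℝ), |∑ p, c σ p * x p| ≤ M * ‖x‖ := by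
    intro σ x
    refine (Finset.abs_sum_le_sum_abs _ _).trans ?_
    have h1 : ∑ p, |c σ p * x p| ≤ (∑ p, |c σ p|) * ‖x‖ := by
      rw [Finset.sum_mul]
      refine Finset.sum_le_sum fun p _ => ?_
      rw [abs_mul]
      exact mul_le_mul_of_nonneg_left (norm_le_pi_norm x p) (abs_nonneg _)
    refine h1.trans (mul_le_mul_of_nonneg_right ?_ (norm_nonneg _))
    exact Finset.single_le_sum (f := fun σ => ∑ p, |c σ p|)
      (fun σ _ => Finset.sum_nonneg fun p _ => abs_nonneg _) (Finset.mem_univ σ)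
  have hcard : (1 : ℝ) ≤ Fintype.card S := by exact_mod_cast Fintype.card_pos
  refine ⟨log (Fintype.card S) + M, fun x => ?_⟩
  have hlog := log_nonneg hcard
  have hx := norm_nonneg x
  have hup : log (∑ σ, exp (∑ p, c σ p * x p)) ≤ log (Fintype.card S) + M * ‖x‖ := by
    rw [log_le_iff_le_exp (sum_exp_pos c x), exp_add, exp_log (by linarith)]
    calc ∑ σ, exp (∑ p, c σ p * x p) ≤ ∑ _σ : S, exp (M * ‖x‖) :=
          Finset.sum_le_sum fun σ _ => exp_le_exp.2 (le_of_abs_le (hL σ x))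
      _ = _ := by simp
  have hlo : -(M * ‖x‖) ≤ log (∑ σ, exp (∑ p, c σ p * x p)) := by
    obtain ⟨σ₀⟩ := ‹Nonempty S›
    rw [le_log_iff_exp_le (sum_exp_pos c x)]
    refine (exp_le_exp.2 (neg_le_of_abs_le (hL σ₀ x))).trans ?_
    exact Finset.single_le_sum (f := fun σ => exp (∑ p, c σ p * x p))
      (fun _ _ => (exp_pos _).le) (Finset.mem_univ σ₀)
  rw [abs_le]
  constructor <;> nlinarith

theorem hasFDerivAt_exp_linear (d : ι → ℝ) (x : ι → ℝ) :
    HasFDerivAt (fun x : ι → ℝ => exp (∑ p, d p * x p))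
      (exp (∑ p, d p * x p) • ∑ p, d p • (ContinuousLinearMap.proj p : (ι → ℝ) →L[ℝ] ℝ)) x := by
  refine HasFDerivAt.exp ?_
  refine HasFDerivAt.fun_sum fun p _ => ?_
  exact ((ContinuousLinearMap.proj p : (ι → ℝ) →L[ℝ] ℝ).hasFDerivAt).const_mul (d p)

theorem polySmooth_log_sum_exp [DecidableEq ι] (c : S → ι → ℝ) :
    PolySmooth (fun x => log (∑ σ, exp (∑ p, c σ p * x p)))
      (fun p => gibbsMean c fun σ => c σ p)
      (fun p x => gibbsMean c (fun σ => c σ p ^ 2) x - gibbsMean c (fun σ => c σ p) x ^ 2) := by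
  obtain ⟨K, hK⟩ := abs_log_sum_exp_le c
  have hF : ∀ x, HasFDerivAt (fun x => log (∑ σ, exp (∑ p, c σ p * x p)))
      (∑ p, gibbsMean c (fun σ => c σ p) x • (ContinuousLinearMap.proj p : (ι → ℝ) →L[ℝ] ℝ))
      x := by
    intro x
    have h := (HasFDerivAt.fun_sum fun σ (_ : σ ∈ (Finset.univ : Finset S)) =>
      hasFDerivAt_exp_linear (c σ) x).log (sum_exp_pos c x).ne'
    convert! h using 1
    simp only [gibbsMean, Finset.smul_sum, smul_smul]
    rw [Finset.sum_comm]
    refine Finset.sum_congr rfl fun p _ => ?_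
    rw [← Finset.sum_smul]
    congr 1
    rw [div_eq_inv_mul, Finset.mul_sum]
    refine Finset.sum_congr rfl fun σ _ => ?_
    ring
  refine ⟨hF, fun p x => ?_, PolyBdd.of_linear ?_ K ?_, fun p => polyBdd_gibbsMean c _,
    fun p => ?_⟩
  · have hs : ∀ t : ℝ, ∀ σ, ∑ q, c σ q * (x + t • Pi.single p 1 : ι → ℝ) q =
        (∑ q, c σ q * x q) + t * c σ p := by
      intro t σ
      simp only [Pi.add_apply, Pi.smul_apply, smul_eq_mul, mul_add, Finset.sum_add_distrib]
      congr 1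
      rw [Finset.sum_eq_single p (fun q _ hq => by simp [hq]) (by simp)]
      simp [mul_comm]
    have hw : ∀ σ, HasDerivAt (fun t : ℝ => exp ((∑ q, c σ q * x q) + t * c σ p))
        (exp (∑ q, c σ q * x q) * c σ p) 0 := by
      intro σ
      have := (((hasDerivAt_id (0 : ℝ)).mul_const (c σ p)).const_add (∑ q, c σ q * x q)).exp
      simpa using this
    have hZ := HasDerivAt.fun_sum fun σ (_ : σ ∈ (Finset.univ : Finset S)) => hw σ
    have hA := HasDerivAt.fun_sum fun σ (_ : σ ∈ (Finset.univ : Finset S)) =>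
      (hw σ).const_mul (c σ p)
    have h0 := (sum_exp_pos c x).ne'
    have h := hA.div hZ (by simpa using h0)
    unfold HasLineDerivAt
    simp only [gibbsMean, hs]
    convert! h using 1
    simp only [zero_mul, add_zero]
    have e1 : ∑ σ, exp (∑ q, c σ q * x q) * c σ p = ∑ σ, c σ p * exp (∑ q, c σ q * x q) :=
      Finset.sum_congr rfl fun σ _ => mul_comm _ _
    have e2 : ∑ σ, c σ p * (exp (∑ q, c σ q * x q) * c σ p) =
        ∑ σ, c σ p ^ 2 * exp (∑ q, c σ q * x q) :=
      Finset.sum_congr rfl fun σ _ => by ring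
    rw [e1, e2]
    field_simp
  · exact continuous_iff_continuousAt.2 fun x => (hF x).continuousAt
  · intro x
    rw [abs_norm]
    exact hK x
  · simpa [sq] using (polyBdd_gibbsMean c _).sub
      ((polyBdd_gibbsMean c fun σ => c σ p).mul (polyBdd_gibbsMean c fun σ => c σ p))

end LogPartition

/-! ### The Sherrington–Kirkpatrick model -/

section SK

variable {N : ℕ} {β : ℝ}

/-- The coefficient of `g p` in the Hamiltonian. -/
def hamCoeff (N : ℕ) (β : ℝ) (σ : Config N) (p : Fin N × Fin N) : ℝ :=
  if p.1 < p.2 then β / √N * (spin (σ p.1) * spin (σ p.2)) else 0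

theorem ham_eq_sum (g : Fin N × Fin N → ℝ) (σ : Config N) :
    ham N β g σ = ∑ p, hamCoeff N β σ p * g p := by
  simp only [ham, hamCoeff, ite_mul, zero_mul]
  rw [← Finset.sum_filter, Finset.mul_sum]
  refine Finset.sum_congr rfl fun p _ => ?_
  ring

theorem spin_sq (b : Bool) : spin b ^ 2 = 1 := by
  cases b <;> simp [spin]

theorem two_mul_sum_lt (a : Fin N → ℝ) :
    2 * ∑ p : Fin N × Fin N, (if p.1 < p.2 then a p.1 * a p.2 else 0) =
      (∑ i, a i) ^ 2 - ∑ i, a i ^ 2 := by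
  have hswap : ∑ p : Fin N × Fin N, (if p.1 < p.2 then a p.1 * a p.2 else 0) =
      ∑ p : Fin N × Fin N, (if p.2 < p.1 then a p.1 * a p.2 else 0) :=
    Fintype.sum_equiv (Equiv.prodComm _ _) _ _ fun p => by simp [mul_comm]
  have hdiag : ∑ i, a i ^ 2 =
      ∑ p : Fin N × Fin N, (if p.1 = p.2 then a p.1 * a p.2 else 0) := by
    simp [Fintype.sum_prod_type, sq]
  have hsq : (∑ i, a i) ^ 2 = ∑ p : Fin N × Fin N, a p.1 * a p.2 := by
    rw [sq, Finset.sum_mul_sum, Fintype.sum_prod_type]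
  rw [two_mul]
  nth_rw 2 [hswap]
  rw [hsq, hdiag, ← Finset.sum_sub_distrib, ← Finset.sum_add_distrib]
  refine Finset.sum_congr rfl fun p _ => ?_
  rcases lt_trichotomy p.1 p.2 with h | h | h
  · simp [h, h.not_gt, h.ne]
  · simp [h]
  · simp [h, h.not_gt, h.ne']

theorem sum_hamCoeff_mul (hN : 1 ≤ N) (σ τ : Config N) :
    ∑ p, hamCoeff N β σ p * hamCoeff N β τ p = β ^ 2 / 2 * (N * ovlp N σ τ ^ 2 - 1) := by
  have hN' : (0 : ℝ) < N := by exact_mod_cast hN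
  have h := two_mul_sum_lt fun i => spin (σ i) * spin (τ i)
  have e : ∀ p, hamCoeff N β σ p * hamCoeff N β τ p = β ^ 2 / N *
      (if p.1 < p.2 then spin (σ p.1) * spin (τ p.1) * (spin (σ p.2) * spin (τ p.2)) else 0) := by
    intro p
    simp only [hamCoeff]
    split_ifs
    · have : β ^ 2 / N = β / √N * (β / √N) := by
        rw [div_mul_div_comm, Real.mul_self_sqrt hN'.le, sq]
      rw [this]; ring
    · simp
  simp only [mul_pow, spin_sq, mul_one, Finset.sum_const, Finset.card_univ, Fintype.card_fin,
    nsmul_eq_mul] at h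
  simp only [e]
  rw [← Finset.mul_sum, eq_div_of_mul_eq two_ne_zero ((mul_comm _ _).trans h), ovlp]
  field_simp

theorem hamT_eq_sum (t : ℝ) (g g' : Fin N × Fin N → ℝ) (σ : Config N) :
    hamT N β t g g' σ = ∑ p, hamCoeff N β σ p * (√t * g p + √(1 - t) * g' p) := by
  simp only [hamT, ham_eq_sum, Finset.mul_sum, ← Finset.sum_add_distrib]
  refine Finset.sum_congr rfl fun p _ => ?_
  ring

/-- The inner product of the gradients of the free energy at two coupled disorders. -/
theorem sum_gibbsMean_mul (hN : 1 ≤ N) (t : ℝ) (g g' g'' : Fin N × Fin N → ℝ) :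
    ∑ p, gibbsMean (hamCoeff N β) (fun σ => hamCoeff N β σ p)
          (fun p => √t * g p + √(1 - t) * g' p) *
        gibbsMean (hamCoeff N β) (fun σ => hamCoeff N β σ p)
          (fun p => √t * g p + √(1 - t) * g'' p) =
      β ^ 2 / 2 * (N * gibbsT N β t g g' g'' (fun ρ => ovlp N ρ.1 ρ.2 ^ 2) - 1) := by
  set x : Fin N × Fin N → ℝ := fun p => √t * g p + √(1 - t) * g' p
  set y : Fin N × Fin N → ℝ := fun p => √t * g p + √(1 - t) * g'' p
  set u : Config N → ℝ := fun σ => exp (∑ p, hamCoeff N β σ p * x p) with hu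
  set v : Config N → ℝ := fun σ => exp (∑ p, hamCoeff N β σ p * y p) with hv
  have hw : ∀ ρ, wT N β t g g' g'' ρ = u ρ.1 * v ρ.2 := fun ρ => by
    simp only [wT, hamT_eq_sum, exp_add, hu, hv, x, y]
  have hZ : ∑ ρ, wT N β t g g' g'' ρ = (∑ σ, u σ) * ∑ τ, v τ := by
    simp only [hw, Fintype.sum_prod_type, Finset.sum_mul_sum]
  have hx : ∑ σ, u σ ≠ 0 := (sum_exp_pos (hamCoeff N β) x).ne'
  have hy : ∑ σ, v σ ≠ 0 := (sum_exp_pos (hamCoeff N β) y).ne'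
  have e1 : ∀ p, gibbsMean (hamCoeff N β) (fun σ => hamCoeff N β σ p) x *
        gibbsMean (hamCoeff N β) (fun σ => hamCoeff N β σ p) y =
      (∑ ρ : Config N × Config N, hamCoeff N β ρ.1 p * hamCoeff N β ρ.2 p * (u ρ.1 * v ρ.2)) /
        ((∑ σ, u σ) * ∑ τ, v τ) := by
    intro p
    rw [gibbsMean, gibbsMean, div_mul_div_comm, Finset.sum_mul_sum, Fintype.sum_prod_type]
    congr 1
    refine Finset.sum_congr rfl fun σ _ => Finset.sum_congr rfl fun τ _ => ?_
    simp only [hu, hv]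
    ring
  simp only [e1]
  rw [← Finset.sum_div, Finset.sum_comm, gibbsT, hZ]
  simp only [← Finset.sum_mul, sum_hamCoeff_mul hN, hw]
  have e2 : ∑ ρ : Config N × Config N,
      β ^ 2 / 2 * (N * ovlp N ρ.1 ρ.2 ^ 2 - 1) * (u ρ.1 * v ρ.2) =
      β ^ 2 / 2 * (N * ∑ ρ : Config N × Config N, ovlp N ρ.1 ρ.2 ^ 2 * (u ρ.1 * v ρ.2)) -
        β ^ 2 / 2 * ((∑ σ, u σ) * ∑ τ, v τ) := by
    rw [← hZ]
    simp only [hw, Finset.mul_sum, ← Finset.sum_sub_distrib]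
    refine Finset.sum_congr rfl fun ρ _ => ?_
    ring
  rw [e2]
  field_simp

theorem nuSK_pos (hβ : β ∈ Set.Ioo (0 : ℝ) 1) : 0 < nuSK β := by
  have h1 : 0 < β ^ 2 := pow_pos hβ.1 2
  have h2 : β ^ 2 < 1 := by nlinarith [hβ.1, hβ.2]
  have := log_lt_sub_one_of_pos (x := 1 - β ^ 2) (by linarith) (by linarith)
  unfold nuSK
  linarith

theorem one_sub_mul_sin_sq_pos (hβ : β ∈ Set.Ioo (0 : ℝ) 1) (θ : ℝ) :
    1 - β ^ 2 ≤ 1 - β ^ 2 * sin θ ^ 2 ∧ 0 < 1 - β ^ 2 := by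
  have h2 : β ^ 2 < 1 := by nlinarith [hβ.1, hβ.2]
  exact ⟨by nlinarith [sin_sq_le_one θ, sq_nonneg β], by linarith⟩

/-- The limiting value of the inner product of gradients, at angle `θ`. -/
def limitOverlap (β θ : ℝ) : ℝ := β ^ 2 / 2 * (1 / (1 - β ^ 2 * sin θ ^ 2) - 1)

theorem continuous_limitOverlap (hβ : β ∈ Set.Ioo (0 : ℝ) 1) : Continuous (limitOverlap β) := by
  have h0 : ∀ θ, 1 - β ^ 2 * sin θ ^ 2 ≠ 0 := fun θ =>
    ((one_sub_mul_sin_sq_pos hβ θ).2.trans_le (one_sub_mul_sin_sq_pos hβ θ).1).ne'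
  unfold limitOverlap
  exact continuous_const.mul ((continuous_const.div (by fun_prop) h0).sub continuous_const)

theorem integral_limitOverlap (hβ : β ∈ Set.Ioo (0 : ℝ) 1) :
    ∫ θ in (0 : ℝ)..(π / 2), 2 * sin θ * cos θ * limitOverlap β θ = nuSK β := by
  have hd : ∀ θ, HasDerivAt
      (fun θ => -(1 / 2) * log (1 - β ^ 2 * sin θ ^ 2) - β ^ 2 * sin θ ^ 2 / 2)
      (2 * sin θ * cos θ * limitOverlap β θ) θ := by
    intro θ
    have h0 : 1 - β ^ 2 * sin θ ^ 2 ≠ 0 :=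
      ((one_sub_mul_sin_sq_pos hβ θ).2.trans_le (one_sub_mul_sin_sq_pos hβ θ).1).ne'
    have h1 : HasDerivAt (fun θ => β ^ 2 * sin θ ^ 2) (β ^ 2 * (2 * sin θ * cos θ)) θ := by
      simpa using ((hasDerivAt_sin θ).pow 2).const_mul (β ^ 2)
    convert! (((h1.const_sub 1).log h0).const_mul (-(1 / 2))).sub (h1.div_const 2) using 1
    rw [limitOverlap]
    field_simp
  have hc : Continuous fun θ => 2 * sin θ * cos θ * limitOverlap β θ :=
    Continuous.mul (by fun_prop) (continuous_limitOverlap hβ)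
  rw [intervalIntegral.integral_eq_sub_of_hasDerivAt (fun θ _ => hd θ)
    (hc.intervalIntegrable _ _)]
  simp [nuSK]

theorem exists_bound_limitOverlap (hβ : β ∈ Set.Ioo (0 : ℝ) 1) :
    ∃ B, ∀ θ, |limitOverlap β θ| ≤ B := by
  refine ⟨β ^ 2 / 2 * (1 / (1 - β ^ 2) + 1), fun θ => ?_⟩
  obtain ⟨h1, h2⟩ := one_sub_mul_sin_sq_pos hβ θ
  have h3 : 0 < 1 / (1 - β ^ 2 * sin θ ^ 2) := one_div_pos.2 (h2.trans_le h1)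
  have h4 := one_div_le_one_div_of_le h2 h1
  rw [limitOverlap, abs_mul, abs_of_nonneg (by positivity)]
  refine mul_le_mul_of_nonneg_left (abs_le.2 ⟨?_, ?_⟩) (by positivity) <;> linarith

/-- The expected overlap discrepancy, written in terms of the gradients of the free energy. -/
theorem integral_overlap_discrepancy (hN : 1 ≤ N) (hβ : 0 < β) {t θ : ℝ} (ht : 0 ≤ t)
    (hs : sin θ = √t) (hc : cos θ = √(1 - t)) :
    ∫ ω, |(N : ℝ) * gibbsT N β t ω.1 ω.2.1 ω.2.2 (fun ρ => ovlp N ρ.1 ρ.2 ^ 2) -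
        1 / (1 - β ^ 2 * t)| ∂disM3 N =
      2 / β ^ 2 * ∫ ω, |(∑ p, gibbsMean (hamCoeff N β) (fun σ => hamCoeff N β σ p)
          (mix Sum.inl θ ω) * gibbsMean (hamCoeff N β) (fun σ => hamCoeff N β σ p)
          (mix Sum.inr θ ω)) - limitOverlap β θ|
        ∂stdPi ((Fin N × Fin N) ⊕ ((Fin N × Fin N) ⊕ (Fin N × Fin N))) := by
  rw [disM3, gaussPi, ← integral_const_mul, ← integral_stdPi_blocks]
  congr 1
  ext ω
  have h := sum_gibbsMean_mul (β := β) hN t (fun p => ω (Sum.inl p))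
    (fun p => ω (Sum.inr (Sum.inl p))) (fun p => ω (Sum.inr (Sum.inr p)))
  have ht2 : sin θ ^ 2 = t := by rw [hs, Real.sq_sqrt ht]
  unfold mix
  rw [hs, hc, h, limitOverlap, ht2, ← mul_sub, abs_mul,
    abs_of_pos (show 0 < β ^ 2 / 2 by positivity), ← mul_assoc]
  have e : 2 / β ^ 2 * (β ^ 2 / 2) = 1 := by field_simp
  rw [e, one_mul]
  congr 1
  ring

/-- The change of variables `t = sin² θ` for a function that is continuous in `θ`. -/
theorem integral_zero_one_eq_integral_sin_sq {H G : ℝ → ℝ} (hG : Continuous G)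
    (h : ∀ t θ, 0 ≤ t → sin θ = √t → cos θ = √(1 - t) → H t = G θ) :
    ∫ t in (0 : ℝ)..1, H t = ∫ θ in (0 : ℝ)..(π / 2), 2 * sin θ * cos θ * G θ := by
  have hH : ContinuousOn H (Set.Icc 0 1) := by
    have hc : Continuous fun t => G (arcsin √t) :=
      hG.comp (continuous_arcsin.comp continuous_sqrt)
    refine hc.continuousOn.congr fun t ht => ?_
    refine h t _ ht.1 (sin_arcsin ?_ ?_) ?_
    · linarith [sqrt_nonneg t]
    · exact sqrt_le_one.2 ht.2
    · rw [cos_arcsin, Real.sq_sqrt ht.1]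
  have key := intervalIntegral.integral_comp_mul_deriv'' (a := 0) (b := π / 2)
    (f := fun θ => sin θ ^ 2) (f' := fun θ => 2 * sin θ * cos θ) (g := H)
    (by fun_prop) (fun θ _ => by
      simpa using ((hasDerivAt_sin θ).fun_pow 2).hasDerivWithinAt) (by fun_prop)
    (hH.mono (by
      rintro _ ⟨θ, -, rfl⟩
      exact ⟨sq_nonneg _, sin_sq_le_one θ⟩))
  simp only [sin_zero, sin_pi_div_two, one_pow, ne_eq, OfNat.ofNat_ne_zero, not_false_eq_true,
    zero_pow] at key
  rw [← key]
  refine intervalIntegral.integral_congr fun θ hθ => ?_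
  rw [Set.uIcc_of_le (by positivity)] at hθ
  have hs : 0 ≤ sin θ := sin_nonneg_of_nonneg_of_le_pi hθ.1 (by linarith [hθ.2, pi_pos])
  have hcos : 0 ≤ cos θ := cos_nonneg_of_mem_Icc ⟨by linarith [hθ.1, pi_pos], hθ.2⟩
  simp only [Function.comp]
  rw [h _ θ (sq_nonneg _) (Real.sqrt_sq hs).symm
    (by rw [← cos_sq', Real.sqrt_sq hcos]), mul_comm]

end SK

/-- Stein's method bound on the total variation distance between the
normalized SK free energy and a standard Gaussian. -/
theorem sk_stein_discrepancy_bound (N : ℕ) (hN : 1 ≤ N)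
    (βN : ℝ) (hβ : βN ∈ Set.Ioo (0 : ℝ) 1) :
    ∀ A : Set ℝ, MeasurableSet A →
      |((gaussPi N) ((fun g => (freeEnergy N βN g -
            ∫ g', freeEnergy N βN g' ∂gaussPi N) / Real.sqrt (nuSK βN)) ⁻¹' A)).toReal -
          ((gaussianReal 0 1) A).toReal| ≤
        βN ^ 2 / nuSK βN * ∫ t in (0 : ℝ)..1,
          ∫ ω, |(N : ℝ) * gibbsT N βN t ω.1 ω.2.1 ω.2.2 (fun ρ => ovlp N ρ.1 ρ.2 ^ 2) -
            1 / (1 - βN ^ 2 * t)| ∂disM3 N := by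
  intro A hA
  have hFE : freeEnergy N βN = fun x => log (∑ σ, exp (∑ p, hamCoeff N βN σ p * x p)) := by
    ext x
    simp only [freeEnergy, partFun, ham_eq_sum]
  have hF := polySmooth_log_sum_exp (hamCoeff N βN)
  obtain ⟨K, hK⟩ := abs_log_sum_exp_le (hamCoeff N βN)
  rw [← hFE] at hF
  simp only [← congrFun hFE] at hK
  obtain ⟨B, hB⟩ := exists_bound_limitOverlap hβ
  have hν := nuSK_pos hβ
  have hq := continuous_limitOverlap hβ
  have hd : PolyBdd
      (fun z : ℝ × ((Fin N × Fin N) ⊕ ((Fin N × Fin N) ⊕ (Fin N × Fin N)) → ℝ) => ‖z.2‖)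
      fun z => |(∑ p, gibbsMean (hamCoeff N βN) (fun σ => hamCoeff N βN σ p)
        (mix Sum.inl z.1 z.2) * gibbsMean (hamCoeff N βN) (fun σ => hamCoeff N βN σ p)
        (mix Sum.inr z.1 z.2)) - limitOverlap βN z.1| :=
    ((PolyBdd.sum _ fun p _ => ((polyBdd_gibbsMean _ _).comp_mix _).mul
      ((polyBdd_gibbsMean _ _).comp_mix _)).sub
      (PolyBdd.of_bounded (by fun_prop) B fun z => hB _)).abs
  rw [integral_zero_one_eq_integral_sin_sq (continuous_const.mul hd.continuous_integral)
    fun t θ ht hs hc => integral_overlap_discrepancy hN hβ.1 ht hs hc]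
  have hβ0 : βN ≠ 0 := hβ.1.ne'
  have hrw : ∀ G : ℝ → ℝ, βN ^ 2 / nuSK βN * ∫ θ in (0 : ℝ)..(π / 2),
      2 * sin θ * cos θ * (2 / βN ^ 2 * G θ) =
      2 / nuSK βN * ∫ θ in (0 : ℝ)..(π / 2), 2 * sin θ * cos θ * G θ := by
    intro G
    simp only [mul_left_comm _ (2 / βN ^ 2)]
    rw [intervalIntegral.integral_const_mul]
    field_simp
  simp only [Pi.mul_apply]
  rw [hrw]
  set W : (Fin N × Fin N → ℝ) → ℝ := fun g => (freeEnergy N βN g -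
    ∫ g', freeEnergy N βN g' ∂gaussPi N) / √(nuSK βN) with hW
  have hWc : Continuous W := (hF.poly.1.sub continuous_const).div_const _
  have : IsProbabilityMeasure ((gaussPi N).map W) :=
    Measure.isProbabilityMeasure_map hWc.aemeasurable
  rw [← Measure.map_apply hWc.measurable hA]
  refine abs_real_sub_real_le _ _ (fun h hh hs h01 => ?_) hA
  obtain ⟨f, f₁, f₂, f₃, hf, hf₁, hf₂, hf₃, h₁, h₂, h₃, hle, heq⟩ :=
    exists_stein_solution hh hs h01
  have key := abs_integral_stein_le hF hK hf hf₁ hf₂ hf₃ h₁ h₂ h₃ hle hν hq hB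
    (integral_limitOverlap hβ)
  refine le_trans (le_of_eq ?_) key
  congr 1
  rw [integral_map hWc.aemeasurable hh.continuous.aestronglyMeasurable]
  have hi : Integrable (fun g => h (W g)) (gaussPi N) :=
    (integrable_const (1 : ℝ)).mono' (hh.continuous.comp hWc).aestronglyMeasurable
      (ae_of_all _ fun x => by
        rw [Real.norm_of_nonneg (h01 _).1]; exact (h01 _).2)
  have e : ∀ g, f₁ (W g) - W g * f (W g) = h (W g) - ∫ z, h z ∂gaussianReal 0 1 :=
    fun g => heq (W g)
  change _ = ∫ g, (f₁ (W g) - W g * f (W g)) ∂gaussPi N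
  simp only [e]
  rw [integral_sub hi (integrable_const _)]
  simp

end
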